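/- arXiv:1101.5830 — 2 statements merged into one kernel-verified Lean document; each statement's English description precedes it below -/
import Mathlib

section
/- There exists α₀ > 0 such that for every α ∈ (0, α₀) there exists η₀ > 0 such that for every η ∈ (0, η₀) there exists n₀ with the following property: if H is a 3-graph on n ≥ n₀ vertices with δ₁(H) ≥ (5/9 − 10η)·C(n,2), then either H contains a matching M with n − 3|M| < η²·n (i.e., leaving strictly fewer than η²n vertices unmatched), or H is α-extremal. -/
/-- The number of `true` entries of a `3 × 3` Boolean matrix. -/
def boolWeight (B : Fin 3 → Fin 3 → Bool) : ℕ := ∑ i, ∑ j, (B i j).toNat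

/-- `B`, read as a bipartite graph, has no perfect matching. -/
def NoPerfect (B : Fin 3 → Fin 3 → Bool) : Prop :=
  ∀ a b c : Fin 3, a ≠ b → b ≠ c → a ≠ c → ¬ (B 0 a = true ∧ B 1 b = true ∧ B 2 c = true)

/-- `B`, read as a bipartite graph, has a matching of size two avoiding row `i` and column `j`. -/
def TwoAvoid (B : Fin 3 → Fin 3 → Bool) (i j : Fin 3) : Prop :=
  ∃ i₁ i₂ j₁ j₂ : Fin 3, (i₁ ≠ i ∧ i₂ ≠ i ∧ i₁ ≠ i₂ ∧ j₁ ≠ j ∧ j₂ ≠ j ∧ j₁ ≠ j₂) ∧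
    B i₁ j₁ = true ∧ B i₂ j₂ = true

theorem forall_bool_matrix {p : (Fin 3 → Fin 3 → Bool) → Prop}
    (h : ∀ a b c d e f g k l : Bool, p ![![a, b, c], ![d, e, f], ![g, k, l]])
    (B : Fin 3 → Fin 3 → Bool) : p B := by
  have hB : B = ![![B 0 0, B 0 1, B 0 2], ![B 1 0, B 1 1, B 1 2], ![B 2 0, B 2 1, B 2 2]] := by
    ext i j
    fin_cases i <;> fin_cases j <;> rfl
  rw [hB]
  exact h _ _ _ _ _ _ _ _ _

instance (B : Fin 3 → Fin 3 → Bool) : Decidable (NoPerfect B) := by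
  unfold NoPerfect; infer_instance

instance (B : Fin 3 → Fin 3 → Bool) (i j : Fin 3) : Decidable (TwoAvoid B i j) := by
  unfold TwoAvoid; infer_instance

theorem boolWeight_le_six (B : Fin 3 → Fin 3 → Bool) (h : NoPerfect B) : boolWeight B ≤ 6 := by
  revert h; revert B
  apply forall_bool_matrix
  decide +kernel

theorem NoPerfect.classify (B : Fin 3 → Fin 3 → Bool) (h : NoPerfect B) (hw : 5 ≤ boolWeight B) :
    (∃ r, ∀ j, B r j = false) ∨ (∃ c, ∀ i, B i c = false) ∨
      ∃ r c, ∀ i j, B i j = (decide (i = r) || decide (j = c)) := by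
  revert hw; revert h; revert B
  apply forall_bool_matrix
  decide +kernel

theorem twoAvoid_of_zero_row (B : Fin 3 → Fin 3 → Bool) (r : Fin 3) (hr : ∀ j, B r j = false)
    (hw : 5 ≤ boolWeight B) (j : Fin 3) : TwoAvoid B r j := by
  revert j; revert hw; revert hr; revert r; revert B
  apply forall_bool_matrix
  decide +kernel

theorem column_of_zero_row (B : Fin 3 → Fin 3 → Bool) (r : Fin 3) (hr : ∀ j, B r j = false)
    (hw : 5 ≤ boolWeight B) (j : Fin 3) : ∃ i, i ≠ r ∧ B i j = true := by
  revert j; revert hw; revert hr; revert r; revert B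
  apply forall_bool_matrix
  decide +kernel

theorem row_of_zero_row (B : Fin 3 → Fin 3 → Bool) (r : Fin 3) (hr : ∀ j, B r j = false)
    (hw : 5 ≤ boolWeight B) (i : Fin 3) (hi : i ≠ r) (j₀ : Fin 3) :
    ∃ j, j ≠ j₀ ∧ B i j = true := by
  revert j₀; revert hi; revert i; revert hw; revert hr; revert r; revert B
  apply forall_bool_matrix
  decide +kernel

theorem full_of_zero_row (B : Fin 3 → Fin 3 → Bool) (r : Fin 3) (hr : ∀ j, B r j = false)
    (hw : boolWeight B = 6) (i : Fin 3) (hi : i ≠ r) (j : Fin 3) : B i j = true := by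
  revert j; revert hi; revert i; revert hw; revert hr; revert r; revert B
  apply forall_bool_matrix
  decide +kernel

theorem exists_twoAvoid (B : Fin 3 → Fin 3 → Bool) (hw : 4 ≤ boolWeight B) :
    ∃ i j, TwoAvoid B i j := by
  revert hw; revert B
  apply forall_bool_matrix
  decide +kernel

theorem exists_off_column (B : Fin 3 → Fin 3 → Bool) (hw : 4 ≤ boolWeight B) (k : Fin 3) :
    ∃ j k', k' ≠ k ∧ B j k' = true := by
  revert k; revert hw; revert B
  apply forall_bool_matrix
  decide +kernel

theorem zero_row_or_column_of_six (B : Fin 3 → Fin 3 → Bool) (h : NoPerfect B)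
    (hw : boolWeight B = 6) : (∃ r, ∀ j, B r j = false) ∨ (∃ c, ∀ i, B i c = false) := by
  revert hw; revert h; revert B
  apply forall_bool_matrix
  decide +kernel

theorem twoAvoid_of_cross (B : Fin 3 → Fin 3 → Bool) (r c : Fin 3)
    (h : ∀ i j, B i j = (decide (i = r) || decide (j = c))) (i j : Fin 3) (hi : i ≠ r)
    (hj : j ≠ c) : TwoAvoid B i j := by
  obtain rfl : B = fun i j => (decide (i = r) || decide (j = c)) := by
    ext i j; rw [h]
  revert i j r c
  decide +kernel

theorem boolWeight_transpose (B : Fin 3 → Fin 3 → Bool) :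
    boolWeight (fun i j => B j i) = boolWeight B := by
  unfold boolWeight
  exact Finset.sum_comm

theorem TwoAvoid.transpose {B : Fin 3 → Fin 3 → Bool} {i j : Fin 3} (h : TwoAvoid B i j) :
    TwoAvoid (fun i j => B j i) j i := by
  obtain ⟨i₁, i₂, j₁, j₂, ⟨a, b, c, d, e, f⟩, g, k⟩ := h
  exact ⟨j₁, j₂, i₁, i₂, ⟨d, e, f, a, b, c⟩, g, k⟩

/-- A system of symmetric `3 × 3` Boolean matrices, viewed as a multipartite graph with parts of
size three, in which no two parts carry three disjoint edges, and no three parts carry four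
disjoint edges. -/
structure IsMatchingTight {ι : Type*} (A : ι → ι → Fin 3 → Fin 3 → Bool) : Prop where
  symm : ∀ x y i j, A y x j i = A x y i j
  pair : ∀ x y, x ≠ y → NoPerfect (A x y)
  triple : ∀ x y z, x ≠ y → x ≠ z → y ≠ z → ∀ i j k k', k ≠ k' → TwoAvoid (A x y) i j →
    A x z i k = true → A y z j k' = true → False

/-- The pair `x, y` is dense, but one of the vertices of one side is isolated. -/
def IsSkew {ι : Type*} (A : ι → ι → Fin 3 → Fin 3 → Bool) (x y : ι) : Prop :=
  x ≠ y ∧ 5 ≤ boolWeight (A x y) ∧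
    ((∃ r, ∀ j, A x y r j = false) ∨ (∃ c, ∀ i, A x y i c = false))

/-- The pair `x, y` carries at most four edges. -/
def IsSparse {ι : Type*} (A : ι → ι → Fin 3 → Fin 3 → Bool) (x y : ι) : Prop :=
  x ≠ y ∧ boolWeight (A x y) ≤ 4

/-- The edges between `x` and `y` are exactly those meeting one fixed vertex on each side. -/
def IsCross {ι : Type*} (A : ι → ι → Fin 3 → Fin 3 → Bool) (x y : ι) : Prop :=
  ∃ r c, ∀ i j, A x y i j = (decide (i = r) || decide (j = c))

namespace IsMatchingTight

variable {ι : Type*} {A : ι → ι → Fin 3 → Fin 3 → Bool}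

theorem transpose_eq (hA : IsMatchingTight A) (x y : ι) : (fun i j => A y x j i) = A x y := by
  ext i j; rw [hA.symm]

theorem boolWeight_comm (hA : IsMatchingTight A) (x y : ι) :
    boolWeight (A y x) = boolWeight (A x y) := by
  rw [← hA.transpose_eq x y]; exact (boolWeight_transpose _).symm

theorem isSkew_symm (hA : IsMatchingTight A) {x y : ι} (h : IsSkew A x y) : IsSkew A y x := by
  obtain ⟨h1, h2, h3⟩ := h
  refine ⟨h1.symm, by rwa [hA.boolWeight_comm], ?_⟩
  rcases h3 with ⟨r, hr⟩ | ⟨r, hr⟩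
  · exact Or.inr ⟨r, fun i => by rw [hA.symm, hr]⟩
  · exact Or.inl ⟨r, fun i => by rw [hA.symm, hr]⟩

theorem isCross_symm (hA : IsMatchingTight A) {x y : ι} (h : IsCross A x y) : IsCross A y x := by
  obtain ⟨r, c, h⟩ := h
  exact ⟨c, r, fun i j => by rw [hA.symm, h, Bool.or_comm]⟩

theorem trichotomy (hA : IsMatchingTight A) {x y : ι} (h : x ≠ y) :
    IsSparse A x y ∨ IsSkew A x y ∨ IsCross A x y := by
  by_cases hw : 5 ≤ boolWeight (A x y)
  · rcases NoPerfect.classify _ (hA.pair x y h) hw with h1 | h1 | h1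
    · exact Or.inr (Or.inl ⟨h, hw, Or.inl h1⟩)
    · exact Or.inr (Or.inl ⟨h, hw, Or.inr h1⟩)
    · exact Or.inr (Or.inr h1)
  · exact Or.inl ⟨h, by omega⟩

theorem zero_row_of_zero_row (hA : IsMatchingTight A) {x y z : ι} (hxy : x ≠ y) (hxz : x ≠ z)
    (hyz : y ≠ z) {r : Fin 3} (hr : ∀ j, A x y r j = false) (hw : 5 ≤ boolWeight (A x y))
    (hw' : 4 ≤ boolWeight (A y z)) (k : Fin 3) : A x z r k = false := by
  by_contra hk
  obtain ⟨j, k', hk', hj⟩ := exists_off_column _ hw' k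
  exact hA.triple x y z hxy hxz hyz r j k k' hk'.symm (twoAvoid_of_zero_row _ r hr hw j)
    (by simpa using hk) hj

theorem false_of_twoAvoid (hA : IsMatchingTight A) {x y z : ι} (hxy : x ≠ y) (hxz : x ≠ z)
    (hyz : y ≠ z) {i i' j k : Fin 3} (hP : TwoAvoid (A y z) j k) (hi : i ≠ i')
    (h1 : A x y i j = true) (h2 : A x z i' k = true) : False :=
  hA.triple y z x hyz hxy.symm hxz.symm j k i i' hi hP (by rw [hA.symm]; exact h1)
    (by rw [hA.symm]; exact h2)

theorem exists_third (r i : Fin 3) (hi : i ≠ r) : ∃ i', i' ≠ r ∧ i' ≠ i := by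
  revert r i; decide

theorem not_dense_of_zero_row (hA : IsMatchingTight A) {x y z : ι} (hxy : x ≠ y) (hxz : x ≠ z)
    (hyz : y ≠ z) {r : Fin 3} (hr : ∀ j, A x y r j = false) (hxyw : 5 ≤ boolWeight (A x y))
    (hxzw : 5 ≤ boolWeight (A x z)) (hyzw : 5 ≤ boolWeight (A y z)) : False := by
  have hr' := hA.zero_row_of_zero_row hxy hxz hyz hr hxyw (by omega)
  rcases NoPerfect.classify _ (hA.pair y z hyz) hyzw with ⟨s, hs⟩ | ⟨s, hs⟩ | ⟨s, t, hst⟩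
  · obtain ⟨i, hi, hij⟩ := column_of_zero_row _ r hr hxyw s
    obtain ⟨i', hi', hii'⟩ := exists_third r i hi
    obtain ⟨k, -, hk⟩ := row_of_zero_row _ r hr' hxzw i' hi' 0
    exact hA.false_of_twoAvoid hxy hxz hyz (twoAvoid_of_zero_row _ s hs hyzw k) hii'.symm hij hk
  · obtain ⟨i, hi, hij⟩ := column_of_zero_row _ r hr' hxzw s
    obtain ⟨i', hi', hii'⟩ := exists_third r i hi
    obtain ⟨k, -, hk⟩ := row_of_zero_row _ r hr hxyw i' hi' 0
    refine hA.false_of_twoAvoid hxy hxz hyz (j := k) (k := s) ?_ hii' hk hij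
    have := (twoAvoid_of_zero_row (fun i j => A y z j i) s hs
      (by rw [boolWeight_transpose]; exact hyzw) k).transpose
    exact this
  · obtain ⟨k, hk⟩ : ∃ k, k ≠ t := exists_ne t
    obtain ⟨i', hi', hik⟩ := column_of_zero_row _ r hr' hxzw k
    obtain ⟨i, hi, hii⟩ := exists_third r i' hi'
    obtain ⟨j, hj, hij⟩ := row_of_zero_row _ r hr hxyw i hi s
    exact hA.false_of_twoAvoid hxy hxz hyz (twoAvoid_of_cross _ s t hst j k hj hk) hii hij hik

theorem isSparse_of_isSkew (hA : IsMatchingTight A) {x y z : ι} (h : IsSkew A x y) (hzx : z ≠ x)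
    (hzy : z ≠ y) : IsSparse A x z ∨ IsSparse A y z := by
  by_contra hcon
  simp only [IsSparse, not_or, not_and, not_le] at hcon
  have h1 := hcon.1 hzx.symm
  have h2 := hcon.2 hzy.symm
  obtain ⟨hxy, hw, ⟨r, hr⟩ | ⟨r, hr⟩⟩ := h
  · exact hA.not_dense_of_zero_row hxy hzx.symm hzy.symm hr hw h1 h2
  · refine hA.not_dense_of_zero_row hxy.symm hzy.symm hzx.symm (r := r) (fun j => ?_) ?_ h2 h1
    · rw [hA.symm, hr]
    · rwa [hA.boolWeight_comm]

theorem boolWeight_le_three_of_zero_row (hA : IsMatchingTight A) {x y z : ι} (hxy : x ≠ y)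
    (hxz : x ≠ z) (hyz : y ≠ z) {r : Fin 3} (hr : ∀ j, A x y r j = false)
    (hxyw : boolWeight (A x y) = 6) (hxzw : boolWeight (A x z) = 6) :
    boolWeight (A y z) ≤ 3 := by
  by_contra hyzw
  have hr' := hA.zero_row_of_zero_row hxy hxz hyz hr (by omega) (by omega)
  obtain ⟨j, k, hjk⟩ := exists_twoAvoid (A y z) (by omega)
  obtain ⟨i, hi⟩ : ∃ i, i ≠ r := exists_ne r
  obtain ⟨i', hi', hii'⟩ := exists_third r i hi
  exact hA.false_of_twoAvoid hxy hxz hyz hjk hii'.symm (full_of_zero_row _ r hr hxyw i hi j)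
    (full_of_zero_row _ r hr' hxzw i' hi' k)

theorem cross_center_eq (hA : IsMatchingTight A) {x y z : ι} (hxy : x ≠ y) (hxz : x ≠ z)
    (hyz : y ≠ z) {r c r' c' : Fin 3}
    (h1 : ∀ i j, A x y i j = (decide (i = r) || decide (j = c)))
    (h2 : ∀ i j, A x z i j = (decide (i = r') || decide (j = c')))
    (h3 : IsCross A y z) : r = r' := by
  by_contra hne
  obtain ⟨s, t, h3⟩ := h3
  obtain ⟨j, hj⟩ : ∃ j, j ≠ c := exists_ne c
  obtain ⟨k, hk⟩ : ∃ k, k ≠ t := exists_ne t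
  exact hA.triple x y z hxy hxz hyz r' j k t hk
    (twoAvoid_of_cross _ r c h1 r' j (Ne.symm hne) hj) (by simp [h2]) (by simp [h3])

end IsMatchingTight

open Finset in
theorem sum_le_sum_add_of_triangle {ι : Type*} [Fintype ι] (d q : ι → ι → ℝ)
    (hd : ∀ x y, 0 ≤ d x y) (hq : ∀ x y, 0 ≤ q x y) (hsymm : ∀ x y, d x y = d y x)
    (hdq : ∀ x y, d x y + q x y ≤ 1)
    (h : ∀ x y z, z ≠ x → z ≠ y → d x y ≤ d x y * (q x z + q y z)) :
    ∑ x, ∑ y, d x y ≤ ∑ x, ∑ y, q x y + 4 * Fintype.card ι := by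
  classical
  set m : ℝ := (Fintype.card ι : ℝ) with hm
  rcases isEmpty_or_nonempty ι with hι | hι
  · simp [hm]
  have hmpos : 0 < m := by rw [hm]; exact_mod_cast Fintype.card_pos
  have hrow : ∀ x, ∑ y, d x y + ∑ y, q x y ≤ m := fun x => by
    rw [← sum_add_distrib]
    calc ∑ y, (d x y + q x y) ≤ ∑ _y : ι, (1 : ℝ) := sum_le_sum fun y _ => hdq x y
      _ = m := by simp [hm]
  have hpair : ∀ x y, d x y * (m - 2) ≤ d x y * (∑ z, q x z) + d x y * (∑ z, q y z) := by
    intro x y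
    have : ∑ z, d x y * (1 - (if z = x then 1 else 0) - (if z = y then 1 else 0)) ≤
        ∑ z, d x y * (q x z + q y z) := by
      refine sum_le_sum fun z _ => ?_
      have h0 : 0 ≤ d x y * (q x z + q y z) :=
        mul_nonneg (hd x y) (add_nonneg (hq x z) (hq y z))
      have h1 := hd x y
      split_ifs with hx hy hy
      · linarith
      · linarith
      · linarith
      · simpa using h x y z hx hy
    rw [← mul_sum, ← mul_sum, sum_add_distrib, sum_sub_distrib, sum_sub_distrib] at this
    simp only [sum_const, card_univ, nsmul_eq_mul, mul_one, sum_ite_eq', mem_univ, if_true] at this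
    rw [← hm] at this
    linarith [this]
  set a : ι → ℝ := fun x => ∑ y, d x y with ha
  set b : ι → ℝ := fun x => ∑ y, q x y with hb
  have ha0 : ∀ x, 0 ≤ a x := fun x => sum_nonneg fun y _ => hd x y
  have hb0 : ∀ x, 0 ≤ b x := fun x => sum_nonneg fun y _ => hq x y
  have key : (∑ x, a x) * (m - 2) ≤ ∑ x, (2 * (a x * b x)) := by
    have h2 : ∑ x, ∑ y, d x y * (m - 2) ≤ ∑ x, ∑ y, (d x y * b x + d x y * b y) :=
      sum_le_sum fun x _ => sum_le_sum fun y _ => hpair x y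
    have h3 : ∑ x, ∑ y, d x y * b y = ∑ x, a x * b x := by
      rw [sum_comm]
      refine sum_congr rfl fun y _ => ?_
      rw [ha, sum_mul]
      exact sum_congr rfl fun x _ => by rw [hsymm]
    have h4 : ∑ x, ∑ y, d x y * b x = ∑ x, a x * b x :=
      sum_congr rfl fun x _ => by rw [ha, sum_mul]
    simp only [sum_add_distrib] at h2
    rw [h3, h4] at h2
    rw [← mul_sum, sum_mul]
    simp only [ha, sum_mul] at h2 ⊢
    linarith
  have hprod : ∑ x, (2 * (a x * b x)) ≤ ∑ x, (m / 2 * (a x + b x)) := by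
    refine sum_le_sum fun x _ => ?_
    have h1 : a x + b x ≤ m := hrow x
    nlinarith [sq_nonneg (a x - b x), ha0 x, hb0 x]
  have htot : ∑ x, a x ≤ m * m := by
    calc ∑ x, a x ≤ ∑ _x : ι, m := sum_le_sum fun x _ => by
          have h1 : a x + b x ≤ m := hrow x
          linarith [hb0 x]
      _ = m * m := by simp [hm]
  have heq : ∑ x, m / 2 * (a x + b x) = m / 2 * (∑ x, a x + ∑ x, b x) := by
    rw [← mul_sum, sum_add_distrib]
  change ∑ x, a x ≤ ∑ x, b x + 4 * m
  have : m * (∑ x, a x) ≤ m * (∑ x, b x + 4 * m) := by nlinarith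
  exact le_of_mul_le_mul_left this hmpos

open Finset in
theorem sq_sum_le_of_cherry {ι : Type*} [Fintype ι] [DecidableEq ι] (r q : ι → ι → ℝ)
    (h : ∀ x y z, r x y * r x z ≤ q y z + if y = z then 1 else 0) :
    (∑ x, ∑ y, r x y) ^ 2 ≤
      (Fintype.card ι : ℝ) ^ 2 * ∑ x, ∑ y, q x y + (Fintype.card ι : ℝ) ^ 3 := by
  set m : ℝ := (Fintype.card ι : ℝ) with hm
  have hm0 : 0 ≤ m := by positivity
  have h1 : ∀ x, (∑ y, r x y) ^ 2 ≤ ∑ y, ∑ z, q y z + m := by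
    intro x
    rw [sq, sum_mul_sum]
    calc ∑ y, ∑ z, r x y * r x z ≤ ∑ y, ∑ z, (q y z + if y = z then 1 else 0) :=
          sum_le_sum fun y _ => sum_le_sum fun z _ => h x y z
      _ = _ := by simp [sum_add_distrib, hm]
  calc (∑ x, ∑ y, r x y) ^ 2 ≤ m * ∑ x, (∑ y, r x y) ^ 2 := by
        simpa [hm] using sq_sum_le_card_mul_sum_sq (s := univ) (f := fun x => ∑ y, r x y)
    _ ≤ m * ∑ _x : ι, (∑ y, ∑ z, q y z + m) := by
        gcongr with x; exact h1 x
    _ = _ := by simp [hm]; ring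

/-- Twice the number of edges of the multipartite graph encoded by `A`. -/
def totalWeight {ι : Type*} [Fintype ι] [DecidableEq ι] (A : ι → ι → Fin 3 → Fin 3 → Bool) : ℝ :=
  ∑ x, ∑ y, if x = y then 0 else (boolWeight (A x y) : ℝ)

namespace IsMatchingTight

variable {ι : Type*} [Fintype ι] {A : ι → ι → Fin 3 → Fin 3 → Bool}

open Classical in
theorem sum_isSkew_le (hA : IsMatchingTight A) :
    ∑ x, ∑ y, (if IsSkew A x y then (1 : ℝ) else 0) ≤
      ∑ x, ∑ y, (if IsSparse A x y then (1 : ℝ) else 0) + 4 * Fintype.card ι := by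
  refine sum_le_sum_add_of_triangle _ _ (fun x y => by positivity) (fun x y => by positivity)
    (fun x y => ?_) (fun x y => ?_) (fun x y z hx hy => ?_)
  · have : IsSkew A x y ↔ IsSkew A y x := ⟨hA.isSkew_symm, hA.isSkew_symm⟩
    simp [this]
  · have : IsSkew A x y → ¬ IsSparse A x y := fun h h' => by
      have := h.2.1; have := h'.2; omega
    split_ifs with h1 h2 <;> simp_all
  · by_cases h : IsSkew A x y
    · rcases hA.isSparse_of_isSkew h hx hy with h' | h'
      · simp only [h, h', if_true]; split_ifs <;> norm_num
      · simp only [h, h', if_true]; split_ifs <;> norm_num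
    · simp [h]

variable [DecidableEq ι]

open Classical in
theorem totalWeight_le_aux (hA : IsMatchingTight A) :
    totalWeight A ≤ 5 * (Fintype.card ι : ℝ) ^ 2 +
      ∑ x, ∑ y, (if x ≠ y ∧ boolWeight (A x y) = 6 then (1 : ℝ) else 0) -
      ∑ x, ∑ y, (if IsSparse A x y then (1 : ℝ) else 0) -
      ∑ x, ∑ y, (if x ≠ y ∧ boolWeight (A x y) ≤ 3 then (1 : ℝ) else 0) := by
  have h5 : 5 * (Fintype.card ι : ℝ) ^ 2 = ∑ _x : ι, ∑ _y : ι, (5 : ℝ) := by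
    simp; ring
  rw [h5]
  simp only [← Finset.sum_add_distrib, ← Finset.sum_sub_distrib, totalWeight]
  refine Finset.sum_le_sum fun x _ => Finset.sum_le_sum fun y _ => ?_
  by_cases hxy : x = y
  · simp [hxy, IsSparse]
  · have h6 := boolWeight_le_six _ (hA.pair x y hxy)
    simp only [IsSparse, hxy, if_false, ne_eq, not_false_eq_true, true_and]
    generalize boolWeight (A x y) = w at *
    interval_cases w <;> norm_num

open Classical in
theorem sum_six_le_sum_isSkew (hA : IsMatchingTight A) :
    ∑ x, ∑ y, (if x ≠ y ∧ boolWeight (A x y) = 6 then (1 : ℝ) else 0) ≤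
      ∑ x, ∑ y, (if IsSkew A x y then (1 : ℝ) else 0) := by
  refine Finset.sum_le_sum fun x _ => Finset.sum_le_sum fun y _ => ?_
  by_cases h : x ≠ y ∧ boolWeight (A x y) = 6
  · have : IsSkew A x y :=
      ⟨h.1, by omega, zero_row_or_column_of_six _ (hA.pair x y h.1) h.2⟩
    simp [h, this]
  · rw [if_neg h]; positivity

theorem totalWeight_le (hA : IsMatchingTight A) :
    totalWeight A ≤ 5 * (Fintype.card ι : ℝ) ^ 2 + 4 * Fintype.card ι := by
  classical
  have h1 := hA.totalWeight_le_aux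
  have h2 := hA.sum_six_le_sum_isSkew
  have h3 := hA.sum_isSkew_le
  have h4 : 0 ≤ ∑ x, ∑ y, (if x ≠ y ∧ boolWeight (A x y) ≤ 3 then (1 : ℝ) else 0) := by
    positivity
  linarith

open Classical in
theorem sq_sum_six_le (hA : IsMatchingTight A) :
    (∑ x, ∑ y, (if x ≠ y ∧ boolWeight (A x y) = 6 then (1 : ℝ) else 0)) ^ 2 ≤
      4 * ((Fintype.card ι : ℝ) ^ 2 *
        ∑ x, ∑ y, (if x ≠ y ∧ boolWeight (A x y) ≤ 3 then (1 : ℝ) else 0) +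
        (Fintype.card ι : ℝ) ^ 3) := by
  set r : ι → ι → ℝ := fun x y =>
    if x ≠ y ∧ boolWeight (A x y) = 6 ∧ ∃ s, ∀ j, A x y s j = false then 1 else 0 with hr
  have h1 : (∑ x, ∑ y, (if x ≠ y ∧ boolWeight (A x y) = 6 then (1 : ℝ) else 0)) ≤
      2 * ∑ x, ∑ y, r x y := by
    have h2 : 2 * ∑ x, ∑ y, r x y = ∑ x, ∑ y, (r x y + r y x) := by
      simp only [Finset.sum_add_distrib]
      rw [Finset.sum_comm (f := fun x y => r y x)]
      ring
    rw [h2]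
    refine Finset.sum_le_sum fun x _ => Finset.sum_le_sum fun y _ => ?_
    have hr0 : ∀ x y, 0 ≤ r x y := fun x y => by simp only [hr]; positivity
    by_cases h : x ≠ y ∧ boolWeight (A x y) = 6
    · rw [if_pos h]
      rcases zero_row_or_column_of_six _ (hA.pair x y h.1) h.2 with h' | ⟨s, hs⟩
      · have : r x y = 1 := if_pos ⟨h.1, h.2, h'⟩
        linarith [hr0 y x]
      · have : r y x = 1 := if_pos ⟨h.1.symm, by rw [hA.boolWeight_comm]; exact h.2, s,
          fun j => by rw [hA.symm, hs]⟩
        linarith [hr0 x y]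
    · rw [if_neg h]; linarith [hr0 x y, hr0 y x]
  have h3 := sq_sum_le_of_cherry r
    (fun x y => if x ≠ y ∧ boolWeight (A x y) ≤ 3 then (1 : ℝ) else 0) (fun x y z => by
      by_cases hyz : y = z
      · simp only [hr, hyz]; split_ifs <;> simp_all
      · by_cases hxy : x ≠ y ∧ boolWeight (A x y) = 6 ∧ ∃ s, ∀ j, A x y s j = false
        · by_cases hxz : x ≠ z ∧ boolWeight (A x z) = 6 ∧ ∃ s, ∀ j, A x z s j = false
          · obtain ⟨h1, h2, s, hs⟩ := hxy
            have := hA.boolWeight_le_three_of_zero_row h1 hxz.1 hyz hs h2 hxz.2.1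
            simp only [hr]
            simp only [ne_eq, hyz, not_false_eq_true, this, and_self, if_true, if_false]
            split_ifs <;> norm_num
          · simp only [hr, if_neg hxz, mul_zero]; positivity
        · simp only [hr, if_neg hxy, zero_mul]; positivity)
  have h0 : 0 ≤ ∑ x, ∑ y, (if x ≠ y ∧ boolWeight (A x y) = 6 then (1 : ℝ) else 0) := by
    positivity
  calc _ ≤ (2 * ∑ x, ∑ y, r x y) ^ 2 := pow_le_pow_left₀ h0 h1 2
    _ = 4 * (∑ x, ∑ y, r x y) ^ 2 := by ring
    _ ≤ _ := by linarith

open Classical in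
theorem sum_not_isCross_le (hA : IsMatchingTight A) {β : ℝ} (hβ : 0 < β)
    (hm : 1000 ≤ β ^ 2 * Fintype.card ι)
    (hS : (5 - β ^ 2 / 1000) * (Fintype.card ι : ℝ) ^ 2 ≤ totalWeight A) (hβ1 : β ≤ 1) :
    ∑ x, ∑ y, (if x ≠ y ∧ ¬ IsCross A x y then (1 : ℝ) else 0) ≤
      β * (Fintype.card ι : ℝ) ^ 2 := by
  have h1 := hA.totalWeight_le_aux
  have h2 := hA.sum_six_le_sum_isSkew
  have h3 := hA.sum_isSkew_le
  have h4 := hA.sq_sum_six_le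
  have h5 : ∑ x, ∑ y, (if x ≠ y ∧ ¬ IsCross A x y then (1 : ℝ) else 0) ≤
      ∑ x, ∑ y, (if IsSkew A x y then (1 : ℝ) else 0) +
      ∑ x, ∑ y, (if IsSparse A x y then (1 : ℝ) else 0) := by
    simp only [← Finset.sum_add_distrib]
    refine Finset.sum_le_sum fun x _ => Finset.sum_le_sum fun y _ => ?_
    by_cases h : x ≠ y ∧ ¬ IsCross A x y
    · rw [if_pos h]
      rcases hA.trichotomy h.1 with h' | h' | h'
      · simp only [h', if_true]; split_ifs <;> norm_num
      · simp only [h', if_true]; split_ifs <;> norm_num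
      · exact absurd h' h.2
    · rw [if_neg h]; positivity
  have h6 : 0 ≤ ∑ x, ∑ y, (if x ≠ y ∧ boolWeight (A x y) ≤ 3 then (1 : ℝ) else 0) := by
    positivity
  set m : ℝ := (Fintype.card ι : ℝ)
  have hm0 : 0 ≤ m := by positivity
  generalize (∑ x, ∑ y, (if x ≠ y ∧ boolWeight (A x y) = 6 then (1 : ℝ) else 0)) = T at *
  generalize (∑ x, ∑ y, (if x ≠ y ∧ boolWeight (A x y) ≤ 3 then (1 : ℝ) else 0)) = q₂ at *
  generalize (∑ x, ∑ y, (if IsSparse A x y then (1 : ℝ) else 0)) = q at *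
  generalize (∑ x, ∑ y, (if IsSkew A x y then (1 : ℝ) else 0)) = s at *
  have hmm : 1000 * m ≤ β ^ 2 * m ^ 2 := by nlinarith
  have hq₂ : q₂ ≤ β ^ 2 / 200 * m ^ 2 := by nlinarith
  have hT : T ^ 2 ≤ (β / 6 * m ^ 2) ^ 2 := by
    have := mul_le_mul_of_nonneg_left hq₂ (sq_nonneg m)
    have := mul_le_mul_of_nonneg_left hmm (sq_nonneg m)
    nlinarith [sq_nonneg (β * m ^ 2)]
  have hT' : T ≤ β / 6 * m ^ 2 := abs_le_of_sq_le_sq' hT (by positivity) |>.2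
  have hββ : β ^ 2 * m ^ 2 ≤ β * m ^ 2 := by
    have : β ^ 2 ≤ β := by nlinarith
    exact mul_le_mul_of_nonneg_right this (sq_nonneg m)
  nlinarith

end IsMatchingTight

namespace IsMatchingTight

variable {ι : Type*} [Fintype ι] [DecidableEq ι] {A : ι → ι → Fin 3 → Fin 3 → Bool}

theorem exists_common_centers (hA : IsMatchingTight A) {β : ℝ} (hβ : 0 < β) (hβ1 : β ≤ 1)
    (hm : 1000 ≤ β ^ 2 * Fintype.card ι)
    (hS : (5 - β ^ 2 / 1000) * (Fintype.card ι : ℝ) ^ 2 ≤ totalWeight A) :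
    ∃ (s : Finset ι) (a : ι → Fin 3), (1 - 2 * β) * Fintype.card ι ≤ s.card ∧
      ∀ x ∈ s, ∀ y ∈ s, x ≠ y → IsCross A x y →
        ∀ i j, A x y i j = (decide (i = a x) || decide (j = a y)) := by
  classical
  have hsum := hA.sum_not_isCross_le hβ hm hS hβ1
  set m : ℝ := (Fintype.card ι : ℝ) with hmdef
  have hmpos : 0 < m := by
    by_contra h
    nlinarith [sq_nonneg β]
  have hne : (Finset.univ : Finset ι).Nonempty := by
    rw [Finset.univ_nonempty_iff, ← Fintype.card_pos_iff]
    rw [hmdef] at hmpos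
    exact_mod_cast hmpos
  obtain ⟨x₀, -, hx₀⟩ : ∃ x₀ ∈ (Finset.univ : Finset ι),
      ∑ y, (if x₀ ≠ y ∧ ¬ IsCross A x₀ y then (1 : ℝ) else 0) ≤ β * m := by
    refine Finset.exists_le_of_sum_le hne (hsum.trans (le_of_eq ?_))
    simp [← hmdef]; ring
  have hdesc : ∀ x, ∃ r : Fin 3, IsCross A x x₀ →
      ∃ c, ∀ i j, A x x₀ i j = (decide (i = r) || decide (j = c)) := fun x => by
    by_cases h : IsCross A x x₀
    · obtain ⟨r, c, h⟩ := h
      exact ⟨r, fun _ => ⟨c, h⟩⟩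
    · exact ⟨0, fun h' => absurd h' h⟩
  choose a ha using hdesc
  refine ⟨Finset.univ.filter fun y => y ≠ x₀ ∧ IsCross A x₀ y, a, ?_, ?_⟩
  · have hpart : (Finset.univ : Finset ι) ⊆
        (Finset.univ.filter fun y => y ≠ x₀ ∧ IsCross A x₀ y) ∪
        ((Finset.univ.filter fun y => x₀ ≠ y ∧ ¬ IsCross A x₀ y) ∪ {x₀}) := by
      intro y _
      by_cases h1 : y = x₀
      · simp [h1]
      · by_cases h2 : IsCross A x₀ y <;> simp [h1, h2, Ne.symm h1, eq_comm]
    have hcard := (Finset.card_le_card hpart).trans ((Finset.card_union_le _ _).trans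
      (Nat.add_le_add_left (Finset.card_union_le _ _) _))
    rw [Finset.sum_boole] at hx₀
    have hcard' : m ≤ ((Finset.univ.filter fun y => y ≠ x₀ ∧ IsCross A x₀ y).card : ℝ) +
        (((Finset.univ.filter fun y => x₀ ≠ y ∧ ¬ IsCross A x₀ y).card : ℝ) + 1) := by
      rw [hmdef]
      simpa using (by exact_mod_cast hcard : ((Finset.univ : Finset ι).card : ℝ) ≤ _)
    have : 1 ≤ β * m := by
      have : β ^ 2 * m ≤ β * m := by
        have : β ^ 2 ≤ β := by nlinarith
        exact mul_le_mul_of_nonneg_right this hmpos.le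
      linarith
    linarith
  · intro x hx y hy hxy hcr i j
    simp only [Finset.mem_filter, Finset.mem_univ, true_and] at hx hy
    have hcx := hA.isCross_symm hx.2
    have hcy := hA.isCross_symm hy.2
    obtain ⟨cx, hx'⟩ := ha x hcx
    obtain ⟨cy, hy'⟩ := ha y hcy
    have hcr' := hcr
    obtain ⟨r, c, hrc⟩ := hcr
    have h1 : r = a x := hA.cross_center_eq hxy hx.1 hy.1 hrc hx' hcy
    have h2 : c = a y := hA.cross_center_eq (r := c) (c := r) hxy.symm hy.1 hx.1
      (fun i j => by rw [hA.symm, hrc, Bool.or_comm]) hy' hcx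
    rw [hrc, h1, h2]

end IsMatchingTight

/-- A family of disjoint triples `f x` of vertices, with set `U` of uncovered vertices, that cannot
be improved by exchanging at most `k` triples for more than `k` disjoint edges of `H`. -/
structure IsOptimalPacking {V ι : Type*} [DecidableEq V] (H : Finset (Finset V))
    (f : ι → Fin 3 → V) (U : Finset V) : Prop where
  card_eq : ∀ e ∈ H, e.card = 3
  inj : ∀ x y i j, f x i = f y j ↔ x = y ∧ i = j
  mem_iff : ∀ v, v ∈ U ↔ ∀ x i, f x i ≠ v
  length_le : ∀ (S : Finset ι) (l : List (Finset V)),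
    (∀ e ∈ l, e ∈ H ∧ ∀ v ∈ e, v ∈ U ∨ ∃ x ∈ S, ∃ i, v = f x i) →
    l.Pairwise Disjoint → l.length ≤ S.card

/-- The vertices of `U` completing `p` and `q` to an edge of `H`. -/
def commonLink {V : Type*} [DecidableEq V] (H : Finset (Finset V)) (U : Finset V) (p q : V) :
    Finset V :=
  U.filter fun u => {u, p, q} ∈ H

/-- The multipartite graph of all pairs that form an edge with at least four vertices of `U`. -/
def heavyPairs {V ι : Type*} [DecidableEq V] [DecidableEq ι] (H : Finset (Finset V))
    (f : ι → Fin 3 → V) (U : Finset V) (x y : ι) (i j : Fin 3) : Bool :=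
  decide (x ≠ y ∧ 4 ≤ (commonLink H U (f x i) (f y j)).card)

theorem exists_four_distinct {V : Type*} [DecidableEq V] {N₁ N₂ N₃ N₄ : Finset V}
    (h₁ : 4 ≤ N₁.card) (h₂ : 4 ≤ N₂.card) (h₃ : 4 ≤ N₃.card) (h₄ : 4 ≤ N₄.card) :
    ∃ u₁ ∈ N₁, ∃ u₂ ∈ N₂, ∃ u₃ ∈ N₃, ∃ u₄ ∈ N₄,
      u₁ ≠ u₂ ∧ u₁ ≠ u₃ ∧ u₁ ≠ u₄ ∧ u₂ ≠ u₃ ∧ u₂ ≠ u₄ ∧ u₃ ≠ u₄ := by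
  obtain ⟨u₁, hu₁⟩ : N₁.Nonempty := Finset.card_pos.1 (by omega)
  obtain ⟨u₂, hu₂, hn₂⟩ := Finset.exists_mem_notMem_of_card_lt_card
    (s := {u₁}) (t := N₂) (by rw [Finset.card_singleton]; omega)
  obtain ⟨u₃, hu₃, hn₃⟩ := Finset.exists_mem_notMem_of_card_lt_card
    (s := {u₁, u₂}) (t := N₃) (by have := Finset.card_le_two (a := u₁) (b := u₂); omega)
  obtain ⟨u₄, hu₄, hn₄⟩ := Finset.exists_mem_notMem_of_card_lt_card
    (s := {u₁, u₂, u₃}) (t := N₄)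
    (by have := Finset.card_le_three (a := u₁) (b := u₂) (c := u₃); omega)
  simp only [Finset.mem_insert, Finset.mem_singleton, not_or] at hn₂ hn₃ hn₄
  exact ⟨u₁, hu₁, u₂, hu₂, u₃, hu₃, u₄, hu₄, Ne.symm hn₂, Ne.symm hn₃.1, Ne.symm hn₄.1,
    Ne.symm hn₃.2, Ne.symm hn₄.2.1, Ne.symm hn₄.2.2⟩

namespace IsOptimalPacking

variable {V ι : Type*} [DecidableEq V] {H : Finset (Finset V)}
  {f : ι → Fin 3 → V} {U : Finset V}

theorem ne_of_mem (h : IsOptimalPacking H f U) {u : V} (hu : u ∈ U) (x : ι) (i : Fin 3) :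
    f x i ≠ u :=
  (h.mem_iff u).1 hu x i

theorem mem_commonLink {p q u : V} : u ∈ commonLink H U p q ↔ u ∈ U ∧ {u, p, q} ∈ H := by
  simp [commonLink]

variable [DecidableEq ι]

theorem heavyPairs_symm (x y : ι) (i j : Fin 3) :
    heavyPairs H f U y x j i = heavyPairs H f U x y i j := by
  unfold heavyPairs commonLink
  simp only [Finset.pair_comm (f y j) (f x i), ne_comm (a := y)]

theorem card_of_heavy {x y : ι} {i j : Fin 3} (h : heavyPairs H f U x y i j = true) :
    4 ≤ (commonLink H U (f x i) (f y j)).card := by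
  unfold heavyPairs at h
  exact (of_decide_eq_true h).2

theorem isMatchingTight (h : IsOptimalPacking H f U) : IsMatchingTight (heavyPairs H f U) where
  symm := heavyPairs_symm
  pair x y hxy a b c hab hbc hac := by
    rintro ⟨h0, h1, h2⟩
    obtain ⟨u₁, h₁, u₂, h₂, u₃, h₃, -, -, h12, h13, -, h23, -, -⟩ :=
      exists_four_distinct (card_of_heavy h0) (card_of_heavy h1) (card_of_heavy h2)
        (card_of_heavy h2)
    rw [mem_commonLink] at h₁ h₂ h₃
    have n₁ := h.ne_of_mem h₁.1
    have n₂ := h.ne_of_mem h₂.1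
    have n₃ := h.ne_of_mem h₃.1
    have := h.length_le {x, y} [{u₁, f x 0, f y a}, {u₂, f x 1, f y b}, {u₃, f x 2, f y c}]
      (by
        simp only [List.mem_cons, List.not_mem_nil, or_false, forall_eq_or_imp, forall_eq]
        simp [h₁, h₂, h₃, h.inj])
      (by
        simp [h.inj, n₂, n₃, h12, h13, h23, (n₁ _ _).symm, (n₂ _ _).symm, hxy, hxy.symm, hab,
          hbc, hac])
    have h2 : ({x, y} : Finset ι).card ≤ 2 := Finset.card_le_two
    simp at this
    omega
  triple x y z hxy hxz hyz i j k k' hkk' := by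
    rintro ⟨i₁, i₂, j₁, j₂, ⟨hi₁, hi₂, hi, hj₁, hj₂, hj⟩, h0, h1⟩ h2 h3
    obtain ⟨u₁, h₁, u₂, h₂, u₃, h₃, u₄, h₄, h12, h13, h14, h23, h24, h34⟩ :=
      exists_four_distinct (card_of_heavy h0) (card_of_heavy h1) (card_of_heavy h2)
        (card_of_heavy h3)
    rw [mem_commonLink] at h₁ h₂ h₃ h₄
    have n₁ := h.ne_of_mem h₁.1
    have n₂ := h.ne_of_mem h₂.1
    have n₃ := h.ne_of_mem h₃.1
    have n₄ := h.ne_of_mem h₄.1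
    have := h.length_le {x, y, z} [{u₁, f x i₁, f y j₁}, {u₂, f x i₂, f y j₂},
      {u₃, f x i, f z k}, {u₄, f y j, f z k'}]
      (by
        simp only [List.mem_cons, List.not_mem_nil, or_false, forall_eq_or_imp, forall_eq]
        simp [h₁, h₂, h₃, h₄, h.inj])
      (by
        simp [h.inj, n₂, n₃, n₄, h12, h13, h14, h23, h24, h34, (n₁ _ _).symm, (n₂ _ _).symm,
          (n₃ _ _).symm, hxy, hxz, hyz, hxy.symm, hyz.symm, hi₁, hi₂, hi, hj₁, hj₂, hj, hkk'])
    have h2 : ({x, y, z} : Finset ι).card ≤ 3 := Finset.card_le_three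
    simp at this
    omega

/-- An edge outside a common cover of three parts allows an exchange. -/
theorem notMem_of_covered (h : IsOptimalPacking H f U) {x₁ x₂ x₃ : ι} (h12 : x₁ ≠ x₂)
    (h13 : x₁ ≠ x₃) (h23 : x₂ ≠ x₃) {i₁ i₂ i₃ : Fin 3} {a : ι → Fin 3}
    (hi₁ : i₁ ≠ a x₁) (hi₂ : i₂ ≠ a x₂) (hi₃ : i₃ ≠ a x₃)
    (hc12 : ∀ j, heavyPairs H f U x₁ x₂ (a x₁) j = true)
    (hc23 : ∀ j, heavyPairs H f U x₂ x₃ (a x₂) j = true)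
    (hc31 : ∀ j, heavyPairs H f U x₃ x₁ (a x₃) j = true) :
    {f x₁ i₁, f x₂ i₂, f x₃ i₃} ∉ H := by
  intro he
  obtain ⟨j₁, hj₁, hj₁'⟩ := IsMatchingTight.exists_third (a x₁) i₁ hi₁
  obtain ⟨j₂, hj₂, hj₂'⟩ := IsMatchingTight.exists_third (a x₂) i₂ hi₂
  obtain ⟨j₃, hj₃, hj₃'⟩ := IsMatchingTight.exists_third (a x₃) i₃ hi₃
  obtain ⟨u₁, h₁, u₂, h₂, u₃, h₃, -, -, g12, g13, -, g23, -, -⟩ :=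
    exists_four_distinct (card_of_heavy (hc12 j₂)) (card_of_heavy (hc23 j₃))
      (card_of_heavy (hc31 j₁)) (card_of_heavy (hc31 j₁))
  rw [mem_commonLink] at h₁ h₂ h₃
  have n₁ := h.ne_of_mem h₁.1
  have n₂ := h.ne_of_mem h₂.1
  have n₃ := h.ne_of_mem h₃.1
  have := h.length_le {x₁, x₂, x₃} [{f x₁ i₁, f x₂ i₂, f x₃ i₃},
    {u₁, f x₁ (a x₁), f x₂ j₂}, {u₂, f x₂ (a x₂), f x₃ j₃}, {u₃, f x₃ (a x₃), f x₁ j₁}]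
    (by
      simp only [List.mem_cons, List.not_mem_nil, or_false, forall_eq_or_imp, forall_eq]
      simp [h₁, h₂, h₃, h.inj, he])
    (by
      simp [h.inj, n₁, n₂, n₃, g12, g13, g23, (n₁ _ _).symm, (n₂ _ _).symm, h12, h13, h23,
        h12.symm, h13.symm, h23.symm, hi₁, hi₂, hi₃, hj₂, hj₃, hj₁.symm, hj₁'.symm, hj₂'.symm,
        hj₃'.symm])
  have h2 : ({x₁, x₂, x₃} : Finset ι).card ≤ 3 := Finset.card_le_three
  simp at this
  omega

end IsOptimalPacking

/-- The vertices of the triples indexed by `s` other than the chosen ones. -/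
def unchosen {V ι : Type*} [DecidableEq V] (f : ι → Fin 3 → V) (s : Finset ι) (a : ι → Fin 3) :
    Finset V :=
  ((s ×ˢ Finset.univ).filter fun p => p.2 ≠ a p.1).image fun p => f p.1 p.2

namespace IsOptimalPacking

variable {V ι : Type*} [DecidableEq V] {H : Finset (Finset V)} {f : ι → Fin 3 → V} {U : Finset V}

theorem mem_unchosen {s : Finset ι} {a : ι → Fin 3} {v : V} :
    v ∈ unchosen f s a ↔ ∃ x ∈ s, ∃ i, i ≠ a x ∧ f x i = v := by
  simp only [unchosen, Finset.mem_image, Finset.mem_filter, Finset.mem_product, Finset.mem_univ,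
    and_true, Prod.exists]
  grind

theorem card_unchosen (h : IsOptimalPacking H f U) (s : Finset ι) (a : ι → Fin 3) :
    (unchosen f s a).card = 2 * s.card := by
  rw [unchosen, Finset.card_image_of_injOn]
  · rw [Finset.card_filter, Finset.sum_product]
    have : ∀ x ∈ s, (∑ i : Fin 3, if i ≠ a x then 1 else 0) = 2 := fun x _ => by
      generalize a x = b
      revert b
      decide
    rw [Finset.sum_congr rfl this]
    simp [mul_comm]
  · rintro ⟨x, i⟩ - ⟨y, j⟩ - hxy
    obtain ⟨rfl, rfl⟩ := (h.inj _ _ _ _).1 hxy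
    rfl

open Classical in
theorem card_edges_unchosen_le [Fintype ι] [DecidableEq ι] (h : IsOptimalPacking H f U)
    {s : Finset ι} {a : ι → Fin 3}
    (hs : ∀ x ∈ s, ∀ y ∈ s, x ≠ y → IsCross (heavyPairs H f U) x y →
      ∀ i j, heavyPairs H f U x y i j = (decide (i = a x) || decide (j = a y))) :
    ((H.filter fun e => e ⊆ unchosen f s a).card : ℝ) ≤ 27 * Fintype.card ι *
      (Fintype.card ι +
        ∑ x, ∑ y, (if x ≠ y ∧ ¬ IsCross (heavyPairs H f U) x y then (1 : ℝ) else 0)) := by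
  set Z : Finset (ι × ι) := Finset.univ.filter fun p =>
    p.1 = p.2 ∨ (p.1 ≠ p.2 ∧ ¬ IsCross (heavyPairs H f U) p.1 p.2) with hZ
  have hZcard : (Z.card : ℝ) ≤ Fintype.card ι +
      ∑ x, ∑ y, (if x ≠ y ∧ ¬ IsCross (heavyPairs H f U) x y then (1 : ℝ) else 0) := by
    rw [hZ, Finset.filter_or]
    refine (Nat.cast_le.2 (Finset.card_union_le _ _)).trans ?_
    rw [Nat.cast_add]
    refine add_le_add (Nat.cast_le.2 ?_) (le_of_eq ?_)
    · refine (Finset.card_le_card_of_injOn Prod.fst (t := Finset.univ) (by simp) ?_).trans_eq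
        Finset.card_univ
      rintro ⟨x, y⟩ h1 ⟨z, w⟩ h2 h3
      simp_all
    · rw [← Finset.sum_product', Finset.univ_product_univ, Finset.sum_boole]
  have hsub : (H.filter fun e => e ⊆ unchosen f s a) ⊆
      (Z ×ˢ (Finset.univ : Finset (ι × Fin 3 × Fin 3 × Fin 3))).image
        fun p => {f p.1.1 p.2.2.1, f p.1.2 p.2.2.2.1, f p.2.1 p.2.2.2.2} := by
    intro e he
    rw [Finset.mem_filter] at he
    obtain ⟨heH, heB⟩ := he
    obtain ⟨v₁, v₂, v₃, -, -, -, rfl⟩ := Finset.card_eq_three.1 (h.card_eq e heH)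
    obtain ⟨x₁, hx₁, i₁, hi₁, rfl⟩ := mem_unchosen.1 (heB (x := v₁) (by simp))
    obtain ⟨x₂, hx₂, i₂, hi₂, rfl⟩ := mem_unchosen.1 (heB (x := v₂) (by simp))
    obtain ⟨x₃, hx₃, i₃, hi₃, rfl⟩ := mem_unchosen.1 (heB (x := v₃) (by simp))
    have hmk : ∀ x y z i j k, (x, y) ∈ Z →
        ({f x i, f y j, f z k} : Finset V) ∈
          (Z ×ˢ (Finset.univ : Finset (ι × Fin 3 × Fin 3 × Fin 3))).image
          fun p => {f p.1.1 p.2.2.1, f p.1.2 p.2.2.2.1, f p.2.1 p.2.2.2.2} :=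
      fun x y z i j k hxy => Finset.mem_image.2 ⟨((x, y), z, i, j, k), by simp [hxy], rfl⟩
    by_cases h12 : (x₁, x₂) ∈ Z
    · exact hmk _ _ _ _ _ _ h12
    by_cases h23 : (x₂, x₃) ∈ Z
    · rw [show ({f x₁ i₁, f x₂ i₂, f x₃ i₃} : Finset V) = {f x₂ i₂, f x₃ i₃, f x₁ i₁} by
        ext; simp; tauto]
      exact hmk _ _ _ _ _ _ h23
    by_cases h31 : (x₃, x₁) ∈ Z
    · rw [show ({f x₁ i₁, f x₂ i₂, f x₃ i₃} : Finset V) = {f x₃ i₃, f x₁ i₁, f x₂ i₂} by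
        ext; simp; tauto]
      exact hmk _ _ _ _ _ _ h31
    simp only [hZ, Finset.mem_filter, Finset.mem_univ, true_and, not_or, not_and, not_not]
      at h12 h23 h31
    have c12 := hs x₁ hx₁ x₂ hx₂ h12.1 (h12.2 h12.1)
    have c23 := hs x₂ hx₂ x₃ hx₃ h23.1 (h23.2 h23.1)
    have c31 := hs x₃ hx₃ x₁ hx₁ h31.1 (h31.2 h31.1)
    exact absurd heH (h.notMem_of_covered h12.1 (Ne.symm h31.1) h23.1 hi₁ hi₂ hi₃
      (fun j => by simp [c12]) (fun j => by simp [c23]) (fun j => by simp [c31]))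
  have hcard := (Finset.card_le_card hsub).trans Finset.card_image_le
  rw [Finset.card_product, Finset.card_univ] at hcard
  simp only [Fintype.card_prod, Fintype.card_fin] at hcard
  have hcard' : ((H.filter fun e => e ⊆ unchosen f s a).card : ℝ) ≤
      Z.card * (Fintype.card ι * (3 * (3 * 3))) := by exact_mod_cast hcard
  refine hcard'.trans ?_
  have := mul_le_mul_of_nonneg_right hZcard
    (show (0 : ℝ) ≤ Fintype.card ι * (3 * (3 * 3)) by positivity)
  linarith

end IsOptimalPacking

theorem two_mul_degree_le {V : Type*} [Fintype V] [DecidableEq V] {H : Finset (Finset V)}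
    (hH : ∀ e ∈ H, e.card = 3) (u : V) :
    2 * (H.filter fun e => u ∈ e).card ≤
      ∑ p, ∑ q, (if {u, p, q} ∈ H then 1 else 0 : ℕ) := by
  rw [← Fintype.sum_prod_type', ← Finset.card_filter]
  have hmaps : Set.MapsTo (fun p : V × V => ({u, p.1, p.2} : Finset V))
      (Finset.univ.filter fun p : V × V => ({u, p.1, p.2} : Finset V) ∈ H)
      (H.filter fun e => u ∈ e) := by
    intro p hp
    simp_all
  rw [Finset.card_eq_sum_card_fiberwise hmaps, mul_comm, ← smul_eq_mul]
  refine Finset.card_nsmul_le_sum _ _ _ fun e he => ?_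
  rw [Finset.mem_filter] at he
  have h2 : (e.erase u).card = 2 := by rw [Finset.card_erase_of_mem he.2, hH e he.1]
  obtain ⟨p, q, hpq, h⟩ := Finset.card_eq_two.1 h2
  have he' : e = {u, p, q} := by rw [← h, Finset.insert_erase he.2]
  subst he'
  rw [← Finset.card_pair (show (p, q) ≠ (q, p) by simp [hpq])]
  refine Finset.card_le_card ?_
  intro z hz
  rw [Finset.mem_insert, Finset.mem_singleton] at hz
  rcases hz with rfl | rfl
  · simp [he.1]
  · simp [he.1, Finset.pair_comm q p]

namespace IsOptimalPacking

variable {V ι : Type*} [DecidableEq V] {H : Finset (Finset V)} {f : ι → Fin 3 → V} {U : Finset V}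

theorem sum_univ_eq [Fintype V] [Fintype ι] (h : IsOptimalPacking H f U) (g : V → ℝ) :
    ∑ v, g v = ∑ v ∈ U, g v + ∑ x, ∑ i, g (f x i) := by
  rw [← Finset.sum_add_sum_compl U g]
  congr 1
  rw [← Fintype.sum_prod_type']
  symm
  refine Finset.sum_bij (fun p _ => f p.1 p.2) ?_ ?_ ?_ fun _ _ => rfl
  · intro p _
    rw [Finset.mem_compl, h.mem_iff]
    push Not
    exact ⟨p.1, p.2, rfl⟩
  · rintro ⟨x, i⟩ - ⟨y, j⟩ - hxy
    obtain ⟨rfl, rfl⟩ := (h.inj _ _ _ _).1 hxy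
    rfl
  · intro v hv
    rw [Finset.mem_compl, h.mem_iff] at hv
    push Not at hv
    obtain ⟨x, i, hv⟩ := hv
    exact ⟨(x, i), Finset.mem_univ _, hv⟩

theorem notMem_of_subset (h : IsOptimalPacking H f U) {e : Finset V} (he : e ⊆ U) : e ∉ H := by
  intro heH
  have := h.length_le ∅ [e] (by simpa using ⟨heH, fun v hv => he hv⟩) (by simp)
  simp at this

/-- If one vertex of a triple has a nonempty link in `U`, the other two have small links. -/
theorem card_link_le (h : IsOptimalPacking H f U) (x : ι) {i j : Fin 3} (hij : i ≠ j)
    (hi : ((U ×ˢ U).filter fun p => {p.1, p.2, f x i} ∈ H).Nonempty) :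
    ((U ×ˢ U).filter fun p => {p.1, p.2, f x j} ∈ H).card ≤ 4 * U.card := by
  obtain ⟨⟨a, b⟩, hab⟩ := hi
  simp only [Finset.mem_filter, Finset.mem_product] at hab
  have hsub : ((U ×ˢ U).filter fun p => {p.1, p.2, f x j} ∈ H) ⊆
      ({a, b} ×ˢ U) ∪ (U ×ˢ {a, b}) := by
    rintro ⟨c, d⟩ hcd
    simp only [Finset.mem_filter, Finset.mem_product] at hcd
    by_contra hn
    simp only [Finset.mem_union, Finset.mem_product, Finset.mem_insert, Finset.mem_singleton,
      hcd.1.1, hcd.1.2, and_true, true_and, not_or] at hn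
    have na := h.ne_of_mem hab.1.1
    have nb := h.ne_of_mem hab.1.2
    have nc := h.ne_of_mem hcd.1.1
    have nd := h.ne_of_mem hcd.1.2
    have := h.length_le {x} [{a, b, f x i}, {c, d, f x j}]
      (by
        simp only [List.mem_cons, List.not_mem_nil, or_false, forall_eq_or_imp, forall_eq]
        simp [hab, hcd, h.inj])
      (by
        simp [h.inj, (na _ _).symm, (nb _ _).symm, nc, nd, hij, Ne.symm hn.1.1, Ne.symm hn.1.2,
          Ne.symm hn.2.1, Ne.symm hn.2.2])
    simp at this
  refine (Finset.card_le_card hsub).trans ((Finset.card_union_le _ _).trans ?_)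
  rw [Finset.card_product, Finset.card_product]
  have h2 : ({a, b} : Finset V).card ≤ 2 := Finset.card_le_two
  nlinarith [Nat.mul_le_mul_right U.card h2]

theorem sum_card_link_le (h : IsOptimalPacking H f U) (x : ι) :
    ∑ i, ((U ×ˢ U).filter fun p => {p.1, p.2, f x i} ∈ H).card ≤ U.card ^ 2 + 12 * U.card := by
  have hpair := fun i j hij => h.card_link_le x (i := i) (j := j) hij
  have hle : ∀ i, ((U ×ˢ U).filter fun p => {p.1, p.2, f x i} ∈ H).card ≤ U.card ^ 2 := fun i => by
    refine (Finset.card_filter_le _ _).trans_eq ?_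
    rw [Finset.card_product, sq]
  have hzero : ∀ i, ((U ×ˢ U).filter fun p => {p.1, p.2, f x i} ∈ H).Nonempty ∨
      ((U ×ˢ U).filter fun p => {p.1, p.2, f x i} ∈ H).card = 0 := fun i => by
    rw [Finset.card_eq_zero]
    exact (Finset.eq_empty_or_nonempty _).symm
  rw [Fin.sum_univ_three]
  have h01 := hpair 0 1 (by decide)
  have h02 := hpair 0 2 (by decide)
  have h10 := hpair 1 0 (by decide)
  have h12 := hpair 1 2 (by decide)
  have h20 := hpair 2 0 (by decide)
  have h21 := hpair 2 1 (by decide)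
  have l0 := hle 0
  have l1 := hle 1
  have l2 := hle 2
  rcases hzero 0 with z0 | z0 <;> rcases hzero 1 with z1 | z1 <;> rcases hzero 2 with z2 | z2 <;>
    simp only [z0, z1, z2, forall_const] at * <;> omega

/-- Double counting of the degrees of the uncovered vertices. -/
theorem sum_degree_le [Fintype V] [Fintype ι] [DecidableEq ι] (h : IsOptimalPacking H f U) :
    2 * ∑ u ∈ U, ((H.filter fun e => u ∈ e).card : ℝ) ≤
      2 * Fintype.card ι * ((U.card : ℝ) ^ 2 + 12 * U.card) + 9 * Fintype.card ι * U.card +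
        U.card * totalWeight (heavyPairs H f U) + 36 * (Fintype.card ι : ℝ) ^ 2 := by
  set T : V → V → V → ℝ := fun u p q => if {u, p, q} ∈ H then 1 else 0 with hT
  have hdeg : ∀ u, 2 * ((H.filter fun e => u ∈ e).card : ℝ) ≤
      ∑ p, ∑ q, T u p q := fun u => by
    have := two_mul_degree_le h.card_eq u
    simp only [hT]
    exact_mod_cast this
  have hUUX : ∀ x, ∑ i, ∑ u ∈ U, ∑ p ∈ U, T u p (f x i) ≤ (U.card : ℝ) ^ 2 + 12 * U.card :=
    fun x => by
      have := h.sum_card_link_le x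
      simp only [Finset.card_filter, Finset.sum_product] at this
      simp only [hT]
      exact_mod_cast this
  have hsplit : ∑ u ∈ U, ∑ p, ∑ q, T u p q =
      ∑ u ∈ U, ∑ p ∈ U, ∑ q ∈ U, T u p q +
      2 * ∑ x, ∑ i, ∑ u ∈ U, ∑ p ∈ U, T u p (f x i) +
      ∑ x, ∑ y, ∑ i, ∑ j, ((commonLink H U (f x i) (f y j)).card : ℝ) := by
    have h1 : ∑ u ∈ U, ∑ p ∈ U, ∑ x, ∑ i, T u p (f x i) =
        ∑ x, ∑ i, ∑ u ∈ U, ∑ p ∈ U, T u p (f x i) := by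
      simp only [Finset.sum_comm (s := U) (t := Finset.univ (α := ι)),
        Finset.sum_comm (s := U) (t := Finset.univ (α := Fin 3))]
    have h2 : ∑ u ∈ U, ∑ x, ∑ i, ∑ q ∈ U, T u (f x i) q =
        ∑ x, ∑ i, ∑ u ∈ U, ∑ p ∈ U, T u p (f x i) := by
      simp only [Finset.sum_comm (s := U) (t := Finset.univ (α := ι)),
        Finset.sum_comm (s := U) (t := Finset.univ (α := Fin 3)), hT, Finset.pair_comm (f _ _)]
    have h3 : ∑ u ∈ U, ∑ x, ∑ i, ∑ y, ∑ j, T u (f x i) (f y j) =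
        ∑ x, ∑ y, ∑ i, ∑ j, ((commonLink H U (f x i) (f y j)).card : ℝ) := by
      simp only [Finset.sum_comm (s := U) (t := Finset.univ (α := ι)),
        Finset.sum_comm (s := U) (t := Finset.univ (α := Fin 3))]
      refine Finset.sum_congr rfl fun x _ => ?_
      rw [Finset.sum_comm]
      simp only [hT, commonLink, Finset.sum_boole]
    simp only [h.sum_univ_eq, Finset.sum_add_distrib, h1, h2, h3]
    ring
  have hUUU : ∑ u ∈ U, ∑ p ∈ U, ∑ q ∈ U, T u p q = 0 :=
    Finset.sum_eq_zero fun u hu => Finset.sum_eq_zero fun p hp => Finset.sum_eq_zero fun q hq =>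
      if_neg (h.notMem_of_subset (by simp [Finset.insert_subset_iff, hu, hp, hq]))
  have hXX : ∀ x y, ∑ i, ∑ j, ((commonLink H U (f x i) (f y j)).card : ℝ) ≤
      (if x = y then 9 * (U.card : ℝ) else 0) +
      U.card * (if x = y then 0 else (boolWeight (heavyPairs H f U x y) : ℝ)) + 36 := fun x y => by
    have hle : ∀ i j, (commonLink H U (f x i) (f y j)).card ≤ U.card := fun i j =>
      Finset.card_filter_le _ _
    split_ifs with hxy
    · have : ∑ i, ∑ j, ((commonLink H U (f x i) (f y j)).card : ℝ) ≤
          ∑ i : Fin 3, ∑ j : Fin 3, (U.card : ℝ) :=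
        Finset.sum_le_sum fun i _ => Finset.sum_le_sum fun j _ => Nat.cast_le.2 (hle i j)
      simp only [Finset.sum_const, Finset.card_univ, Fintype.card_fin, nsmul_eq_mul] at this
      push_cast at this
      linarith
    · have : ∑ i, ∑ j, ((commonLink H U (f x i) (f y j)).card : ℝ) ≤
          ∑ i : Fin 3, ∑ j : Fin 3,
            ((U.card : ℝ) * ((heavyPairs H f U x y i j).toNat : ℝ) + 4) :=
        Finset.sum_le_sum fun i _ => Finset.sum_le_sum fun j _ => by
          by_cases hc : 4 ≤ (commonLink H U (f x i) (f y j)).card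
          · have : heavyPairs H f U x y i j = true := decide_eq_true ⟨hxy, hc⟩
            have h2 : ((commonLink H U (f x i) (f y j)).card : ℝ) ≤ U.card :=
              Nat.cast_le.2 (hle i j)
            rw [this]
            simp
            linarith
          · have h2 : ((commonLink H U (f x i) (f y j)).card : ℝ) ≤ 4 := by
              exact_mod_cast (not_le.1 hc).le
            have : (0 : ℝ) ≤ (U.card : ℝ) * ((heavyPairs H f U x y i j).toNat : ℝ) := by
              positivity
            linarith
      simp only [Finset.sum_add_distrib, ← Finset.mul_sum, Finset.sum_const, Finset.card_univ,
        Fintype.card_fin, nsmul_eq_mul] at this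
      rw [boolWeight]
      push_cast at this ⊢
      linarith
  have hXX' := Finset.sum_le_sum fun x (_ : x ∈ Finset.univ) =>
    Finset.sum_le_sum fun y (_ : y ∈ Finset.univ) => hXX x y
  have hUUX' := Finset.sum_le_sum fun x (_ : x ∈ Finset.univ) => hUUX x
  simp only [Finset.sum_add_distrib, ← Finset.mul_sum, Finset.sum_const, Finset.card_univ,
    nsmul_eq_mul, Finset.sum_ite_eq, Finset.mem_univ, if_true] at hXX' hUUX'
  have := Finset.sum_le_sum fun u (_ : u ∈ U) => hdeg u
  rw [hsplit, hUUU, ← Finset.mul_sum] at this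
  rw [totalWeight]
  nlinarith

end IsOptimalPacking

/-- A maximum matching is an optimal packing. -/
theorem exists_isOptimalPacking {V : Type*} [Fintype V] [DecidableEq V] {H : Finset (Finset V)}
    (hH : ∀ e ∈ H, e.card = 3) :
    ∃ M : Finset (Finset V), M ⊆ H ∧ (M : Set (Finset V)).Pairwise (fun e f => Disjoint e f) ∧
      ∃ (f : M → Fin 3 → V) (U : Finset V), IsOptimalPacking H f U ∧
        U.card + 3 * M.card = Fintype.card V := by
  classical
  obtain ⟨M, hM, hmax⟩ := Finset.exists_max_image
    (H.powerset.filter fun M : Finset (Finset V) =>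
      (M : Set (Finset V)).Pairwise fun e f => Disjoint e f)
    Finset.card ⟨∅, by simp⟩
  simp only [Finset.mem_filter, Finset.mem_powerset] at hM hmax
  obtain ⟨hMH, hMd⟩ := hM
  set g : (e : M) → e.1 ≃ Fin 3 := fun e => Finset.equivFinOfCardEq (hH e.1 (hMH e.2)) with hg
  set f : M → Fin 3 → V := fun e i => (g e).symm i with hf
  have hfmem : ∀ e i, f e i ∈ e.1 := fun e i => ((g e).symm i).2
  have hfsurj : ∀ (e : M) v, v ∈ e.1 → ∃ i, f e i = v := fun e v hv =>
    ⟨g e ⟨v, hv⟩, by simp [hf]⟩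
  have hU : ∀ v, v ∈ Finset.univ \ M.biUnion id ↔ ∀ x i, f x i ≠ v := by
    intro v
    simp only [Finset.mem_sdiff, Finset.mem_univ, true_and, Finset.mem_biUnion, id, not_exists,
      not_and]
    refine ⟨fun h x i hx => h x.1 x.2 (hx ▸ hfmem x i), fun h e he hv => ?_⟩
    obtain ⟨i, hi⟩ := hfsurj ⟨e, he⟩ v hv
    exact h _ _ hi
  refine ⟨M, hMH, hMd, f, Finset.univ \ M.biUnion id, ⟨hH, ?_, hU, ?_⟩, ?_⟩
  · intro x y i j
    refine ⟨fun h => ?_, fun h => by rw [h.1, h.2]⟩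
    have hxy : x = y := by
      by_contra hne
      have hd := hMd x.2 y.2 (fun h => hne (Subtype.ext h))
      exact Finset.disjoint_left.1 hd (hfmem x i) (h ▸ hfmem y j)
    subst hxy
    exact ⟨rfl, (g x).symm.injective (Subtype.ext h)⟩
  · intro S l hl hld
    have hne : ∀ e ∈ H, ∃ v, v ∈ e := fun e he => Finset.card_pos.1 (by rw [hH e he]; norm_num)
    have hlnd : l.Nodup := by
      refine List.Pairwise.imp_of_mem (fun {a b} ha hb hab => ?_) hld
      rintro rfl
      obtain ⟨v, hv⟩ := hne a (hl a ha).1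
      exact Finset.disjoint_left.1 hab hv hv
    have hcross : ∀ e ∈ M \ S.image Subtype.val, ∀ e' ∈ l, Disjoint e e' := by
      intro e he e' he'
      rw [Finset.mem_sdiff] at he
      refine Finset.disjoint_left.2 fun v hv hv' => ?_
      rcases (hl e' he').2 v hv' with h | ⟨x, hx, i, rfl⟩
      · obtain ⟨i, hi⟩ := hfsurj ⟨e, he.1⟩ v hv
        exact (hU v).1 h _ _ hi
      · refine he.2 (Finset.mem_image.2 ⟨x, hx, ?_⟩)
        by_contra hxe
        exact Finset.disjoint_left.1 (hMd x.2 he.1 hxe) (hfmem x i) hv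
    have hcard := hmax ((M \ S.image Subtype.val) ∪ l.toFinset) ⟨?_, ?_⟩
    · rw [Finset.card_union_of_disjoint, List.toFinset_card_of_nodup hlnd,
        Finset.card_sdiff_of_subset, Finset.card_image_of_injective _ Subtype.val_injective]
        at hcard
      · have : S.card ≤ M.card := by
          simpa using Finset.card_le_univ S
        omega
      · exact Finset.image_subset_iff.2 fun x _ => x.2
      · refine Finset.disjoint_left.2 fun e he he' => ?_
        obtain ⟨v, hv⟩ := hne e (hMH (Finset.mem_sdiff.1 he).1)
        exact Finset.disjoint_left.1 (hcross e he e (List.mem_toFinset.1 he')) hv hv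
    · exact Finset.union_subset (Finset.sdiff_subset.trans hMH) fun e he =>
        (hl e (List.mem_toFinset.1 he)).1
    · intro e he e' he' hee
      simp only [Finset.coe_union, Set.mem_union, Finset.mem_coe, List.mem_toFinset] at he he'
      rcases he with he | he <;> rcases he' with he' | he'
      · exact hMd (Finset.mem_sdiff.1 he).1 (Finset.mem_sdiff.1 he').1 hee
      · exact hcross e he e' he'
      · exact (hcross e' he' e he).symm
      · exact hld.forall he he' hee
  · have hb : (M.biUnion id).card = 3 * M.card := by
      rw [Finset.card_biUnion (t := id) hMd,
        Finset.sum_const_nat (m := 3) fun e he => hH (id e) (hMH he), mul_comm]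
    rw [← hb, Finset.card_sdiff_add_card_eq_card (Finset.subset_univ _), Finset.card_univ]

theorem uncovered_le_and_le_weight {η u m n W : ℝ} (hη : 0 < η) (hm : 0 ≤ m)
    (hn : n = 3 * m + u) (hn0 : 0 < n) (hu : η ^ 2 * n ≤ u) (hlarge : 12 + 4 / η ^ 2 ≤ η * n)
    (hW : W ≤ 5 * m ^ 2 + 4 * m)
    (hdeg : u * ((5 / 9 - 10 * η) * (n * (n - 1))) ≤
      2 * m * (u ^ 2 + 12 * u) + 9 * m * u + u * W + 36 * m ^ 2) :
    u ≤ 27 * η * n ∧ 5 * m ^ 2 - 11 * η * n ^ 2 ≤ W := by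
  have hη2 : 0 < η ^ 2 := by positivity
  have hu0 : 0 < u := lt_of_lt_of_le (by positivity) hu
  have hmn : 3 * m ≤ n := by linarith
  have h36 : 36 * m ^ 2 ≤ u * (4 / η ^ 2 * n) := by
    have h1 : n ≤ u / η ^ 2 := by rw [le_div_iff₀ hη2]; linarith
    have h2 : u * (4 / η ^ 2 * n) = 4 * n * (u / η ^ 2) := by ring
    rw [h2]
    nlinarith [mul_le_mul_of_nonneg_left h1 hn0.le]
  have hdiv : (5 / 9 - 10 * η) * (n * (n - 1)) ≤ 2 * m * u + 33 * m + W + 4 / η ^ 2 * n := by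
    refine le_of_mul_le_mul_left ?_ hu0
    linarith
  have hnn : (12 + 4 / η ^ 2) * n ≤ η * n * n := mul_le_mul_of_nonneg_right hlarge hn0.le
  have hηn : 0 ≤ η * n := by positivity
  have hmu : 0 ≤ m * u := by positivity
  have hkey : 5 * m ^ 2 + 4 / 9 * (u * n) - 11 * η * n ^ 2 ≤ W := by
    have h59 : 5 / 9 * n ^ 2 = 5 * m ^ 2 + 10 / 3 * (m * u) + 5 / 9 * u ^ 2 := by rw [hn]; ring
    have hun : u * n = 3 * (m * u) + u ^ 2 := by rw [hn]; ring
    nlinarith [sq_nonneg u]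
  have hun : 0 ≤ u * n := by positivity
  refine ⟨?_, by linarith⟩
  have h4 : 4 / 9 * (u * n) ≤ 12 * (η * n * n) := by
    have : 0 ≤ 4 / η ^ 2 * n := by positivity
    nlinarith
  have : u * n ≤ 27 * η * n * n := by linarith
  exact le_of_mul_le_mul_right this hn0

theorem lt_mul_choose_three {β m : ℝ} {b : ℕ} (hβ : 0 < β) (hβ1 : β < 1 / 400)
    (hm : 1000 ≤ β ^ 2 * m) (hb : 2 * ((1 - 2 * β) * m) ≤ b) :
    27 * m * (m + β * m ^ 2) < 40 * β * b.choose 3 := by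
  have hm0 : 0 < m := pos_of_mul_pos_right (by linarith : 0 < β ^ 2 * m) (sq_nonneg β)
  have hβm : 1000 ≤ β * m := by nlinarith [mul_pos hβ hm0]
  have hβm' : β * m ≤ 1 / 400 * m := by gcongr
  have hchoose : ((b + 1 - 3 : ℕ) ^ 3 : ℝ) / (Nat.factorial 3 : ℝ) ≤ b.choose 3 :=
    Nat.pow_le_choose 3 b
  have hfact : (Nat.factorial 3 : ℝ) = 6 := by norm_num [Nat.factorial]
  have hbm : 1.9 * m ≤ (b + 1 - 3 : ℕ) := by
    have h1 : (b : ℝ) ≤ (b + 1 - 3 : ℕ) + 2 := by exact_mod_cast (by omega : b ≤ b + 1 - 3 + 2)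
    linarith
  have hcube := pow_le_pow_left₀ (by positivity) hbm 3
  rw [hfact] at hchoose
  have hlow : 1.1 * m ^ 3 ≤ b.choose 3 := by linarith [pow_pos hm0 3]
  have h1 := mul_le_mul_of_nonneg_left hlow hβ.le
  have h2 := mul_le_mul_of_nonneg_left hβm (sq_nonneg m)
  have h3 := mul_pos hβ (pow_pos hm0 3)
  linarith

/-- Non-extremal case: for `0 < η ≪ α ≪ 1` and `n` large, every 3-graph `H` on `n`
vertices with `δ₁(H) ≥ (5/9 − 10η)·C(n,2)` either contains a matching leaving strictly
fewer than `η²n` vertices unmatched, or `H` is `α`-extremal (there is `B ⊆ V` with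
`|B| ≥ (2/3 − α)n` and fewer than `α·C(|B|,3)` edges inside `B`). -/
theorem stmt3 :
    ∃ α₀ : ℝ, 0 < α₀ ∧ ∀ α : ℝ, 0 < α → α < α₀ →
    ∃ η₀ : ℝ, 0 < η₀ ∧ ∀ η : ℝ, 0 < η → η < η₀ →
    ∃ n₀ : ℕ, ∀ n : ℕ, n₀ ≤ n →
    ∀ (V : Type) [Fintype V] [DecidableEq V], Fintype.card V = n →
    ∀ H : Finset (Finset V), (∀ e ∈ H, e.card = 3) →
    (∀ v : V, (5 / 9 - 10 * η) * (n.choose 2 : ℝ) ≤ ((H.filter fun e => v ∈ e).card : ℝ)) →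
    (∃ M : Finset (Finset V), M ⊆ H ∧
        (M : Set (Finset V)).Pairwise (fun e f => Disjoint e f) ∧
        (n : ℝ) - 3 * M.card < η ^ 2 * n) ∨
    (∃ B : Finset V, (2 / 3 - α) * n ≤ (B.card : ℝ) ∧
        ((H.filter fun e => e ⊆ B).card : ℝ) < α * (B.card.choose 3 : ℝ)) := by
  refine ⟨1 / 10, by norm_num, fun α hα hα1 => ?_⟩
  obtain ⟨β, rfl⟩ : ∃ β, α = 40 * β := ⟨α / 40, by ring⟩
  have hβ : 0 < β := by linarith
  have hβ1 : β < 1 / 400 := by linarith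
  refine ⟨β ^ 2 / 10 ^ 6, by positivity, fun η hη hηβ => ?_⟩
  refine ⟨⌈(12 + 4 / η ^ 2) / η⌉₊ + ⌈4000 / β ^ 2⌉₊ + 1, fun n hn V _ _ hV H hH hdeg => ?_⟩
  have hn1 : (12 + 4 / η ^ 2) / η ≤ n := (Nat.le_ceil _).trans (Nat.cast_le.2 (by omega))
  have hn2 : 4000 / β ^ 2 ≤ n := (Nat.le_ceil _).trans (Nat.cast_le.2 (by omega))
  have hn0 : (0 : ℝ) < n := Nat.cast_pos.2 (by omega)
  rw [div_le_iff₀ hη] at hn1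
  rw [div_le_iff₀ (by positivity)] at hn2
  obtain ⟨M, hMH, hMd, f, U, h, hU⟩ := exists_isOptimalPacking hH
  have hcard : (n : ℝ) = 3 * (M.card : ℝ) + U.card := by
    rw [← hV, ← hU]
    push_cast
    ring
  by_cases hsmall : (n : ℝ) - 3 * M.card < η ^ 2 * n
  · exact Or.inl ⟨M, hMH, hMd, hsmall⟩
  right
  have hA := h.isMatchingTight
  have hW := hA.totalWeight_le
  have hsum := h.sum_degree_le
  have hlow : (U.card : ℝ) * ((5 / 9 - 10 * η) * (n * (n - 1))) ≤
      2 * ∑ u ∈ U, ((H.filter fun e => u ∈ e).card : ℝ) := by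
    have := Finset.card_nsmul_le_sum U _ _ fun u _ => hdeg u
    rw [nsmul_eq_mul, Nat.cast_choose_two] at this
    linarith
  have hMcard : Fintype.card M = M.card := Fintype.card_coe M
  rw [hMcard] at hW hsum
  obtain ⟨hu, hW'⟩ := uncovered_le_and_le_weight hη (Nat.cast_nonneg M.card) hcard hn0
    (by linarith) (by linarith) hW (hlow.trans hsum)
  have hβ2 : β ^ 2 ≤ β / 400 := by nlinarith
  have hmn : (n : ℝ) ≤ 4 * M.card := by nlinarith
  have hm : 1000 ≤ β ^ 2 * M.card := by nlinarith [sq_nonneg β]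
  have hS : (5 - β ^ 2 / 1000) * (M.card : ℝ) ^ 2 ≤ totalWeight (heavyPairs H f U) := by
    have h1 : (n : ℝ) ^ 2 ≤ 16 * (M.card : ℝ) ^ 2 := by nlinarith
    have h2 : η * (n : ℝ) ^ 2 ≤ β ^ 2 / 10 ^ 6 * (16 * (M.card : ℝ) ^ 2) :=
      mul_le_mul hηβ.le h1 (by positivity) (by positivity)
    nlinarith [sq_nonneg (β * M.card)]
  rw [← hMcard] at hm hS
  obtain ⟨s, a, hs, hsa⟩ := hA.exists_common_centers hβ (by linarith) hm hS
  have hcross := hA.sum_not_isCross_le hβ hm hS (by linarith)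
  have hB := h.card_edges_unchosen_le hsa
  have hBcard := h.card_unchosen s a
  rw [hMcard] at hs hcross hB hm
  refine ⟨unchosen f s a, ?_, ?_⟩
  · rw [hBcard]
    push_cast
    nlinarith
  · refine (hB.trans (by gcongr)).trans_lt (lt_mul_choose_three hβ hβ1 hm ?_)
    rw [hBcard]
    push_cast
    linarith
end

section
/- There exists α₀ > 0 such that for every α ∈ (0, α₀) there exists n₀ with the following property: if n ≥ n₀ is divisible by 3 and H is a 3-graph on n vertices that is α-extremal and satisfies δ₁(H) ≥ C(n−1,2) − C(2n/3,2) + 1, then H contains a perfect matching. -/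
/-- A tripartite 3-graph with parts of equal size in which every vertex misses few pairs has a
perfect matching. -/
lemma exists_perm_of_few_missing {ι : Type*} [Fintype ι] [DecidableEq ι]
    (R : ι → ι → ι → Prop) [∀ x y z, Decidable (R x y z)] (d : ℕ)
    (hd : 3 * d + 3 * Fintype.card ι < Fintype.card ι ^ 2)
    (h₁ : ∀ x, (Finset.univ.filter fun p : ι × ι => ¬ R x p.1 p.2).card ≤ d)
    (h₂ : ∀ y, (Finset.univ.filter fun p : ι × ι => ¬ R p.1 y p.2).card ≤ d)
    (h₃ : ∀ z, (Finset.univ.filter fun p : ι × ι => ¬ R p.1 p.2 z).card ≤ d) :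
    ∃ σ τ π : Equiv.Perm ι, ∀ i, R (σ i) (τ i) (π i) := by
  obtain ⟨⟨σ, τ, π⟩, hmax⟩ := Finite.exists_max
    (fun s : Equiv.Perm ι × Equiv.Perm ι × Equiv.Perm ι =>
      (Finset.univ.filter fun i => R (s.1 i) (s.2.1 i) (s.2.2 i)).card)
  refine ⟨σ, τ, π, fun o => ?_⟩
  by_contra ho
  have hcard : ∀ (f g : Equiv.Perm ι) (P : ι × ι → Prop) [DecidablePred P],
      (Finset.univ.filter P).card ≤ d →
      (Finset.univ.filter fun p : ι × ι => P (f p.1, g p.2)).card ≤ d := by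
    intro f g P _ h
    refine le_trans (Finset.card_le_card_of_injOn (fun p => (f p.1, g p.2)) ?_ ?_) h
    · intro p hp
      simpa using hp
    · rintro ⟨x, y⟩ - ⟨x', y'⟩ - h
      simpa using h
  have hcard' : ∀ (f g : Equiv.Perm ι) (P : ι × ι → Prop) [DecidablePred P],
      (Finset.univ.filter P).card ≤ d →
      (Finset.univ.filter fun p : ι × ι => P (f p.2, g p.1)).card ≤ d := by
    intro f g P _ h
    refine le_trans (Finset.card_le_card_of_injOn (fun p => (f p.2, g p.1)) ?_ ?_) h
    · intro p hp
      simpa using hp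
    · rintro ⟨x, y⟩ - ⟨x', y'⟩ - h
      simpa [and_comm] using h
  have e₁ := hcard τ π (fun p => ¬ R (σ o) p.1 p.2) (h₁ _)
  have e₂ := hcard' σ π (fun p => ¬ R p.1 (τ o) p.2) (h₂ _)
  have e₃ := hcard σ τ (fun p => ¬ R p.1 p.2 (π o)) (h₃ _)
  have e₄ : (Finset.univ.image fun i : ι => (i, i)).card ≤ Fintype.card ι :=
    Finset.card_image_le
  have e₅ : (Finset.univ.image fun i : ι => (o, i)).card ≤ Fintype.card ι :=
    Finset.card_image_le
  have e₆ : (Finset.univ.image fun i : ι => (i, o)).card ≤ Fintype.card ι :=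
    Finset.card_image_le
  obtain ⟨⟨i, j⟩, hij⟩ : ∃ p : ι × ι, p ∉
      (((((Finset.univ.filter fun p : ι × ι => ¬ R (σ o) (τ p.1) (π p.2)) ∪
      (Finset.univ.filter fun p : ι × ι => ¬ R (σ p.2) (τ o) (π p.1))) ∪
      (Finset.univ.filter fun p : ι × ι => ¬ R (σ p.1) (τ p.2) (π o))) ∪
      (Finset.univ.image fun i : ι => (i, i))) ∪
      (Finset.univ.image fun i : ι => (o, i))) ∪
      (Finset.univ.image fun i : ι => (i, o)) := by
    by_contra! hall
    have := Finset.card_le_card (fun p (_ : p ∈ (Finset.univ : Finset (ι × ι))) => hall p)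
    grw [Finset.card_union_le, Finset.card_union_le, Finset.card_union_le,
      Finset.card_union_le, Finset.card_union_le, e₁, e₂, e₃, e₄, e₅, e₆] at this
    simp only [Finset.card_univ, Fintype.card_prod] at this
    nlinarith
  simp only [Finset.mem_union, Finset.mem_filter, Finset.mem_univ, true_and, Finset.mem_image,
    Prod.mk.injEq, not_or, not_not, not_exists, not_and] at hij
  obtain ⟨⟨⟨⟨⟨r₁, r₂⟩, r₃⟩, hne⟩, hi⟩, hj⟩ := hij
  have hne : i ≠ j := fun h => hne i rfl h
  have hi : i ≠ o := fun h => hi j h.symm rfl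
  have hj : j ≠ o := fun h => hj i rfl h.symm
  have := hmax ((Equiv.swap i j).trans σ, (Equiv.swap o i).trans τ, (Equiv.swap o j).trans π)
  refine absurd this (not_le.2 (Finset.card_lt_card ?_))
  refine Finset.ssubset_iff_subset_ne.2 ⟨?_, ?_⟩
  · intro k hk
    replace hk : R (σ k) (τ k) (π k) := (Finset.mem_filter.1 hk).2
    refine Finset.mem_filter.2 ⟨Finset.mem_univ _, ?_⟩
    change R (σ (Equiv.swap i j k)) (τ (Equiv.swap o i k)) (π (Equiv.swap o j k))
    by_cases k₁ : k = o
    · subst k₁; exact absurd hk ho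
    by_cases k₂ : k = i
    · subst k₂
      rwa [Equiv.swap_apply_left, Equiv.swap_apply_right, Equiv.swap_apply_of_ne_of_ne hi hne]
    by_cases k₃ : k = j
    · subst k₃
      rwa [Equiv.swap_apply_right, Equiv.swap_apply_right,
        Equiv.swap_apply_of_ne_of_ne hj hne.symm]
    rwa [Equiv.swap_apply_of_ne_of_ne k₂ k₃, Equiv.swap_apply_of_ne_of_ne k₁ k₂,
      Equiv.swap_apply_of_ne_of_ne k₁ k₃]
  · intro h
    have : o ∈ Finset.univ.filter fun i => R (σ i) (τ i) (π i) := by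
      refine h.symm ▸ ?_
      refine Finset.mem_filter.2 ⟨Finset.mem_univ _, ?_⟩
      change R (σ (Equiv.swap i j o)) (τ (Equiv.swap o i o)) (π (Equiv.swap o j o))
      rwa [Equiv.swap_apply_left, Equiv.swap_apply_left, Equiv.swap_apply_of_ne_of_ne hi.symm hj.symm]
    exact ho (by simpa using this)

/-- The set `S` is the vertex set of a matching of `H`. -/
def Tileable {V : Type*} [DecidableEq V] (H : Finset (Finset V)) (S : Finset V) : Prop :=
  ∃ M : Finset (Finset V), M ⊆ H ∧
    (M : Set (Finset V)).Pairwise (fun e f => Disjoint e f) ∧ M.biUnion id = S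

section
variable {V : Type*} [DecidableEq V] {H : Finset (Finset V)}

lemma tileable_biUnion {ι : Type*} (I : Finset ι) (e : ι → Finset V) (he : ∀ i ∈ I, e i ∈ H)
    (hd : (I : Set ι).Pairwise fun i j => Disjoint (e i) (e j)) : Tileable H (I.biUnion e) := by
  refine ⟨I.image e, ?_, ?_, ?_⟩
  · intro x hx
    obtain ⟨i, hi, rfl⟩ := Finset.mem_image.1 hx
    exact he i hi
  · intro x hx y hy hxy
    obtain ⟨i, hi, rfl⟩ := Finset.mem_image.1 hx
    obtain ⟨j, hj, rfl⟩ := Finset.mem_image.1 hy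
    exact hd hi hj (fun h => hxy (h ▸ rfl))
  · rw [Finset.image_biUnion]; rfl

lemma tileable_empty : Tileable H ∅ := ⟨∅, by simp⟩

lemma tileable_of_mem {e : Finset V} (he : e ∈ H) : Tileable H e :=
  ⟨{e}, by simpa using he, by simp, by simp⟩

lemma Tileable.union {S S' : Finset V} (h : Tileable H S) (h' : Tileable H S')
    (hd : Disjoint S S') : Tileable H (S ∪ S') := by
  obtain ⟨M, hM, hp, rfl⟩ := h
  obtain ⟨M', hM', hp', rfl⟩ := h'
  rw [Finset.disjoint_biUnion_left] at hd
  simp only [Finset.disjoint_biUnion_right, id] at hd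
  refine ⟨M ∪ M', Finset.union_subset hM hM', ?_, ?_⟩
  · intro e he f hf hne
    simp only [Finset.coe_union, Set.mem_union, Finset.mem_coe] at he hf
    rcases he with he | he <;> rcases hf with hf | hf
    · exact hp he hf hne
    · exact hd e he f hf
    · exact (hd f hf e he).symm
    · exact hp' he hf hne
  · rw [Finset.union_biUnion]

lemma card_filter_product_self_le (P : V × V → Prop) [DecidablePred P] {S S' W : Finset V}
    (h : S ⊆ S' ∪ W) :
    ((S ×ˢ S).filter P).card ≤ ((S' ×ˢ S').filter P).card + 2 * W.card * S.card := by
  have hsub : (S ×ˢ S).filter P ⊆ ((S' ×ˢ S').filter P ∪ W ×ˢ S) ∪ S ×ˢ W := by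
    rintro ⟨x, y⟩ hp
    simp only [Finset.mem_filter, Finset.mem_product, Finset.mem_union] at hp ⊢
    have hx := h hp.1.1
    have hy := h hp.1.2
    simp only [Finset.mem_union] at hx hy
    tauto
  have := Finset.card_le_card hsub
  grw [Finset.card_union_le, Finset.card_union_le] at this
  rw [Finset.card_product, Finset.card_product] at this
  nlinarith

/-- Vertices of `X` with many pairs in `B` can be greedily covered by disjoint edges using two
vertices of `B`. -/
lemma exists_tileable_greedy (h3 : ∀ e ∈ H, e.card = 3) (X B U : Finset V) (hXB : Disjoint X B)
    (hX : ∀ a ∈ X, 2 * (U.card + 2 * X.card) * B.card <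
      ((B ×ˢ B).filter fun p => ({a, p.1, p.2} : Finset V) ∈ H).card) :
    ∃ Y ⊆ B, Disjoint Y U ∧ Y.card = 2 * X.card ∧ Tileable H (X ∪ Y) := by
  induction X using Finset.induction_on with
  | empty => exact ⟨∅, by simp, by simp, by simp, by simpa using tileable_empty⟩
  | insert a X ha ih =>
    rw [Finset.disjoint_insert_left] at hXB
    obtain ⟨Y, hY, hYU, hYc, hT⟩ := ih hXB.2 (fun b hb => by
      refine lt_of_le_of_lt ?_ (hX b (Finset.mem_insert_of_mem hb))
      gcongr
      exact Finset.subset_insert _ _)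
    have hlt := hX a (Finset.mem_insert_self _ _)
    have hle := card_filter_product_self_le (fun p => ({a, p.1, p.2} : Finset V) ∈ H)
      (S := B) (S' := B \ (U ∪ Y)) (W := U ∪ Y) (by
        intro x hx
        by_cases h : x ∈ U ∪ Y
        · exact Finset.mem_union_right _ h
        · exact Finset.mem_union_left _ (Finset.mem_sdiff.2 ⟨hx, h⟩))
    have hU : (U ∪ Y).card ≤ U.card + 2 * (insert a X).card := by
      grw [Finset.card_union_le, hYc, Finset.card_insert_of_notMem ha]
      omega
    have hpos : 0 < (((B \ (U ∪ Y)) ×ˢ (B \ (U ∪ Y))).filter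
        fun p => ({a, p.1, p.2} : Finset V) ∈ H).card := by
      have : 2 * (U ∪ Y).card * B.card ≤ 2 * (U.card + 2 * (insert a X).card) * B.card := by
        gcongr
      omega
    obtain ⟨⟨x, y⟩, hxy⟩ := Finset.card_pos.1 hpos
    simp only [Finset.mem_filter, Finset.mem_product, Finset.mem_sdiff, Finset.mem_union,
      not_or] at hxy
    obtain ⟨⟨⟨hxB, hxU, hxY⟩, hyB, hyU, hyY⟩, he⟩ := hxy
    have hc := h3 _ he
    have hxy : x ≠ y := by
      rintro rfl
      have := Finset.card_le_two (a := a) (b := x)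
      simp at hc
      omega
    refine ⟨insert x (insert y Y), ?_, ?_, ?_, ?_⟩
    · intro z hz
      simp only [Finset.mem_insert] at hz
      rcases hz with rfl | rfl | hz
      exacts [hxB, hyB, hY hz]
    · simp [hxU, hyU, hYU]
    · rw [Finset.card_insert_of_notMem (by simp [hxy, hxY]), Finset.card_insert_of_notMem hyY,
        Finset.card_insert_of_notMem ha, hYc]
      ring
    · have hd : Disjoint (X ∪ Y) {a, x, y} := by
        have hxX : x ∉ X := fun h => Finset.disjoint_left.1 hXB.2 h hxB
        have hyX : y ∉ X := fun h => Finset.disjoint_left.1 hXB.2 h hyB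
        have haY : a ∉ Y := fun h => hXB.1 (hY h)
        simp [*]
      have := hT.union (tileable_of_mem he) hd
      convert this using 1
      ext z
      simp only [Finset.mem_union, Finset.mem_insert, Finset.mem_singleton]
      tauto

/-- If `|B| = 2|A|` and every vertex misses few triples with one vertex in `A` and two in `B`, then
`A ∪ B` can be tiled by such triples. -/
lemma tileable_union_of_few_missing {A B : Finset V} (hAB : Disjoint A B)
    (hcard : B.card = 2 * A.card) (d : ℕ) (hd : 3 * d + 3 * A.card < A.card ^ 2)
    (hA : ∀ a ∈ A, ((B ×ˢ B).filter fun p => ({a, p.1, p.2} : Finset V) ∉ H).card ≤ d)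
    (hB : ∀ b ∈ B, ((A ×ˢ B).filter fun p => ({b, p.1, p.2} : Finset V) ∉ H).card ≤ d) :
    Tileable H (A ∪ B) := by
  obtain ⟨P, hPB, hP⟩ := Finset.exists_subset_card_eq (s := B) (n := A.card) (by omega)
  have hQ : (B \ P).card = A.card := by
    rw [Finset.card_sdiff_of_subset hPB]; omega
  set Q := B \ P with hQdef
  have hQB : Q ⊆ B := Finset.sdiff_subset
  have hBPQ : B = P ∪ Q := (Finset.union_sdiff_of_subset hPB).symm
  have hPQ : Disjoint P Q := Finset.disjoint_sdiff
  let a := (A.equivFin).symm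
  let b := (P.equivFinOfCardEq hP).symm
  let c := (Q.equivFinOfCardEq hQ).symm
  obtain ⟨σ, τ, π, h⟩ := exists_perm_of_few_missing
    (fun i j k : Fin A.card => ({(a i : V), (b j : V), (c k : V)} : Finset V) ∈ H) d
    (by simpa using hd)
    (fun x => by
      refine le_trans (Finset.card_le_card_of_injOn (fun p => ((b p.1 : V), (c p.2 : V))) ?_ ?_)
        (hA (a x) (a x).2)
      · intro p hp
        simp only [Finset.coe_filter, Finset.mem_univ, true_and, Set.mem_ofPred_eq] at hp
        simp only [Finset.coe_filter, Finset.mem_product, Set.mem_ofPred_eq]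
        exact ⟨⟨hPB (b _).2, hQB (c _).2⟩, hp⟩
      · rintro ⟨x, y⟩ - ⟨x', y'⟩ - h
        simpa [Subtype.coe_injective.eq_iff] using h)
    (fun y => by
      refine le_trans (Finset.card_le_card_of_injOn (fun p => ((a p.1 : V), (c p.2 : V))) ?_ ?_)
        (hB (b y) (hPB (b y).2))
      · intro p hp
        simp only [Finset.coe_filter, Finset.mem_univ, true_and, Set.mem_ofPred_eq] at hp
        simp only [Finset.coe_filter, Finset.mem_product, Set.mem_ofPred_eq]
        rw [Finset.insert_comm]
        exact ⟨⟨(a _).2, hQB (c _).2⟩, hp⟩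
      · rintro ⟨x, y⟩ - ⟨x', y'⟩ - h
        simpa [Subtype.coe_injective.eq_iff] using h)
    (fun z => by
      refine le_trans (Finset.card_le_card_of_injOn (fun p => ((a p.1 : V), (b p.2 : V))) ?_ ?_)
        (hB (c z) (hQB (c z).2))
      · intro p hp
        simp only [Finset.coe_filter, Finset.mem_univ, true_and, Set.mem_ofPred_eq] at hp
        simp only [Finset.coe_filter, Finset.mem_product, Set.mem_ofPred_eq]
        rw [Finset.insert_comm, Finset.pair_comm]
        exact ⟨⟨(a _).2, hPB (b _).2⟩, hp⟩
      · rintro ⟨x, y⟩ - ⟨x', y'⟩ - h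
        simpa [Subtype.coe_injective.eq_iff] using h)
  have hT := tileable_biUnion (H := H) Finset.univ
    (fun i => ({(a (σ i) : V), (b (τ i) : V), (c (π i) : V)} : Finset V)) (fun i _ => h i) (by
      intro i _ j _ hij
      have haa : ∀ k l, (a k : V) = a l → k = l := fun k l h => a.injective (Subtype.ext h)
      have hbb : ∀ k l, (b k : V) = b l → k = l := fun k l h => b.injective (Subtype.ext h)
      have hcc : ∀ k l, (c k : V) = c l → k = l := fun k l h => c.injective (Subtype.ext h)
      have hab : ∀ k l, (a k : V) ≠ b l := fun k l h =>
        Finset.disjoint_left.1 hAB (a k).2 (h ▸ hPB (b l).2)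
      have hac : ∀ k l, (a k : V) ≠ c l := fun k l h =>
        Finset.disjoint_left.1 hAB (a k).2 (h ▸ hQB (c l).2)
      have hbc : ∀ k l, (b k : V) ≠ c l := fun k l h =>
        Finset.disjoint_left.1 hPQ (b k).2 (h ▸ (c l).2)
      rw [Finset.disjoint_left]
      intro x hx hy
      simp only [Finset.mem_insert, Finset.mem_singleton] at hx hy
      rcases hx with rfl | rfl | rfl <;> rcases hy with h | h | h
      · exact hij (σ.injective (haa _ _ h))
      · exact hab _ _ h
      · exact hac _ _ h
      · exact hab _ _ h.symm
      · exact hij (τ.injective (hbb _ _ h))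
      · exact hbc _ _ h
      · exact hac _ _ h.symm
      · exact hbc _ _ h.symm
      · exact hij (π.injective (hcc _ _ h)))
  convert hT using 1
  ext x
  rw [hBPQ]
  simp only [Finset.mem_union, Finset.mem_biUnion, Finset.mem_univ, true_and, Finset.mem_insert,
    Finset.mem_singleton]
  constructor
  · rintro (hx | hx | hx)
    · exact ⟨σ.symm (a.symm ⟨x, hx⟩), Or.inl (by simp)⟩
    · exact ⟨τ.symm (b.symm ⟨x, hx⟩), Or.inr (Or.inl (by simp))⟩
    · exact ⟨π.symm (c.symm ⟨x, hx⟩), Or.inr (Or.inr (by simp))⟩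
  · rintro ⟨i, rfl | rfl | rfl⟩
    · exact Or.inl (a _).2
    · exact Or.inr (Or.inl (b _).2)
    · exact Or.inr (Or.inr (c _).2)

lemma card_filter_product_eq_sum (v : V) (S S' : Finset V) :
    ((S ×ˢ S').filter fun p => ({v, p.1, p.2} : Finset V) ∈ H).card =
      ∑ x ∈ S, ∑ y ∈ S', if ({v, x, y} : Finset V) ∈ H then 1 else 0 := by
  rw [Finset.card_filter, Finset.sum_product]

/-- If all vertices of `B` have degree at least `D` and at most `Δ` inside `B`, then `H[B]` has a
matching of size about `|B| D / (9 Δ)`. -/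
lemma exists_tileable_of_degree_bounds (h3 : ∀ e ∈ H, e.card = 3) (B : Finset V) (t D Δ : ℕ)
    (hmin : ∀ v ∈ B, D ≤ ((B ×ˢ B).filter fun p => ({v, p.1, p.2} : Finset V) ∈ H).card)
    (hmax : ∀ v ∈ B, ((B ×ˢ B).filter fun p => ({v, p.1, p.2} : Finset V) ∈ H).card ≤ Δ)
    (h : 9 * t * Δ < B.card * D) :
    ∃ S ⊆ B, S.card = 3 * (t + 1) ∧ Tileable H S := by
  suffices key : ∀ k ≤ t + 1, ∃ S ⊆ B, S.card = 3 * k ∧ Tileable H S from key _ le_rfl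
  intro k
  induction k with
  | zero => exact fun _ => ⟨∅, by simp, by simp, tileable_empty⟩
  | succ k ih =>
    intro hk
    obtain ⟨S, hSB, hS, hT⟩ := ih (by omega)
    by_cases hex : ∃ e ∈ H, e ⊆ B ∧ Disjoint S e
    · obtain ⟨e, he, heB, hd⟩ := hex
      refine ⟨S ∪ e, Finset.union_subset hSB heB, ?_, hT.union (tileable_of_mem he) hd⟩
      rw [Finset.card_union_of_disjoint hd, hS, h3 e he]
      ring
    · exfalso
      push Not at hex
      simp only [card_filter_product_eq_sum] at hmin hmax
      set f : V → V → V → ℕ := fun v x y => if ({v, x, y} : Finset V) ∈ H then 1 else 0 with hf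
      have hlow : B.card * D ≤ ∑ v ∈ B, ∑ x ∈ B, ∑ y ∈ B, f v x y := by
        rw [← smul_eq_mul]
        exact Finset.card_nsmul_le_sum _ _ _ hmin
      have hS' : ∑ v ∈ B, (if v ∈ S then ∑ x ∈ B, ∑ y ∈ B, f v x y else 0) ≤ 3 * k * Δ := by
        rw [← Finset.sum_filter, ← hS, ← smul_eq_mul]
        refine (Finset.sum_le_card_nsmul _ _ Δ fun v hv => hmax v (Finset.mem_filter.1 hv).1).trans ?_
        gcongr
        intro v hv
        exact (Finset.mem_filter.1 hv).2
      have hup : ∑ v ∈ B, ∑ x ∈ B, ∑ y ∈ B, f v x y ≤ ∑ v ∈ B, ∑ x ∈ B, ∑ y ∈ B,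
          ((if v ∈ S then f v x y else 0) + (if x ∈ S then f x v y else 0) +
            (if y ∈ S then f y v x else 0)) := by
        refine Finset.sum_le_sum fun v hv => Finset.sum_le_sum fun x hx =>
          Finset.sum_le_sum fun y hy => ?_
        have h₁ : ({x, v, y} : Finset V) = {v, x, y} := Finset.insert_comm _ _ _
        have h₂ : ({y, v, x} : Finset V) = {v, x, y} := by
          rw [Finset.insert_comm, Finset.pair_comm]
        simp only [hf, h₁, h₂]
        by_cases he : ({v, x, y} : Finset V) ∈ H
        · have := hex _ he (by
            intro z hz
            simp only [Finset.mem_insert, Finset.mem_singleton] at hz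
            rcases hz with rfl | rfl | rfl <;> assumption)
          have : v ∈ S ∨ x ∈ S ∨ y ∈ S := by
            by_contra! hn
            apply this
            simp [hn]
          simp only [he, if_true]
          rcases this with h | h | h <;> simp only [h, if_true] <;> omega
        · simp [he]
      have e₁ : ∑ v ∈ B, ∑ x ∈ B, ∑ y ∈ B, (if v ∈ S then f v x y else 0) =
          ∑ v ∈ B, (if v ∈ S then ∑ x ∈ B, ∑ y ∈ B, f v x y else 0) := by
        refine Finset.sum_congr rfl fun v _ => ?_
        split_ifs <;> simp
      have e₂ : ∑ v ∈ B, ∑ x ∈ B, ∑ y ∈ B, (if x ∈ S then f x v y else 0) =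
          ∑ v ∈ B, (if v ∈ S then ∑ x ∈ B, ∑ y ∈ B, f v x y else 0) := by
        rw [Finset.sum_comm, ← e₁]
      have e₃ : ∑ v ∈ B, ∑ x ∈ B, ∑ y ∈ B, (if y ∈ S then f y v x else 0) =
          ∑ v ∈ B, (if v ∈ S then ∑ x ∈ B, ∑ y ∈ B, f v x y else 0) := by
        rw [← e₁, Finset.sum_congr rfl (fun v _ => Finset.sum_comm), Finset.sum_comm]
      simp only [Finset.sum_add_distrib] at hup
      rw [e₁, e₂, e₃] at hup
      have : 3 * k * Δ ≤ 3 * t * Δ := by gcongr; omega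
      nlinarith

lemma card_link_univ_le [Fintype V] (h3 : ∀ e ∈ H, e.card = 3) {B : Finset V} {v : V} (hv : v ∈ B) :
    ((Finset.univ ×ˢ Finset.univ).filter fun p => ({v, p.1, p.2} : Finset V) ∈ H).card +
        ((B.card : ℤ) - 1) * (B.card - 2) ≤
      ((B ×ˢ B).filter fun p => ({v, p.1, p.2} : Finset V) ∈ H).card +
        ((Fintype.card V : ℤ) - 1) * (Fintype.card V - 2) := by
  have hsub : (Finset.univ ×ˢ Finset.univ).filter (fun p => ({v, p.1, p.2} : Finset V) ∈ H) ⊆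
      (B ×ˢ B).filter (fun p => ({v, p.1, p.2} : Finset V) ∈ H) ∪
        ((Finset.univ.erase v).offDiag \ (B.erase v).offDiag) := by
    rintro ⟨x, y⟩ hp
    simp only [Finset.mem_filter, Finset.mem_product, Finset.mem_univ, true_and] at hp
    have hc := h3 _ hp
    have hvx : x ≠ v := by
      rintro rfl
      have := Finset.card_le_two (a := x) (b := y)
      simp at hc
      omega
    have hvy : y ≠ v := by
      rintro rfl
      have := Finset.card_le_two (a := x) (b := y)
      rw [Finset.insert_comm] at hc
      simp at hc
      omega
    have hxy : x ≠ y := by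
      rintro rfl
      have := Finset.card_le_two (a := v) (b := x)
      simp at hc
      omega
    simp only [Finset.mem_union, Finset.mem_filter, Finset.mem_product, Finset.mem_sdiff,
      Finset.mem_offDiag, Finset.mem_erase, Finset.mem_univ]
    tauto
  have hle := Finset.card_le_card hsub
  have hsub' : (B.erase v).offDiag ⊆ (Finset.univ.erase v).offDiag :=
    Finset.offDiag_mono (Finset.erase_subset_erase _ (Finset.subset_univ _))
  have hoff : ∀ S : Finset V, v ∈ S →
      ((S.erase v).offDiag.card : ℤ) = ((S.card : ℤ) - 1) * (S.card - 2) := by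
    intro S hS
    have h₁ := Finset.card_erase_add_one hS
    have h₂ := Finset.offDiag_card (S.erase v)
    have h₃ : (S.erase v).card ≤ (S.erase v).card * (S.erase v).card := Nat.le_mul_self _
    rw [h₂, Nat.cast_sub h₃, ← h₁]
    push_cast
    ring
  have hsd := Finset.card_sdiff_add_card_eq_card hsub'
  have h₁ := hoff B hv
  have h₂ := hoff Finset.univ (Finset.mem_univ v)
  rw [Finset.card_univ] at h₂
  grw [Finset.card_union_le] at hle
  zify at hle hsd
  linarith

/-- The perfect matching, given a partition `A ∪ B` with `|B| ≈ 2|A|` in which almost all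
triples with at least one vertex in `A` are edges, apart from few exceptional vertices `X ⊆ A`. -/
lemma tileable_univ_of_partition [Fintype V] (h3 : ∀ e ∈ H, e.card = 3) (m : ℕ) (hm : 10000 ≤ m)
    (hV : Fintype.card V = 3 * m) (A B X : Finset V) (hAB : Disjoint A B)
    (hU : A ∪ B = Finset.univ) (hXA : X ⊆ A)
    (hB : ∀ b ∈ B, ∀ Y ⊆ A, ∀ Z : Finset V,
      (((Y ×ˢ Z).filter fun p => ({b, p.1, p.2} : Finset V) ∉ H).card : ℝ) ≤ 2 / 100 * m ^ 2)
    (hBB : ∀ b ∈ B,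
      (((B ×ˢ B).filter fun p => ({b, p.1, p.2} : Finset V) ∈ H).card : ℝ) ≤ 2 / 100 * m ^ 2)
    (hA : ∀ a ∈ A \ X,
      (((B ×ˢ B).filter fun p => ({a, p.1, p.2} : Finset V) ∉ H).card : ℝ) ≤ 2 / 100 * m ^ 2)
    (hX : ∀ a ∈ X, 8 / 1000 * (m : ℝ) ^ 2 ≤
      ((B ×ˢ B).filter fun p => ({a, p.1, p.2} : Finset V) ∈ H).card)
    (hXc : (X.card : ℝ) ≤ 2 / 10000 * m)
    (hA₁ : (A.card : ℝ) ≤ (1 + 2 / 10000) * m) (hA₂ : (1 - 2 / 10000) * m ≤ (A.card : ℝ))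
    (hdeg : ∀ v, 5 * (m : ℤ) ^ 2 - 7 * m + 4 ≤
      ((Finset.univ ×ˢ Finset.univ).filter fun p => ({v, p.1, p.2} : Finset V) ∈ H).card) :
    Tileable H Finset.univ := by
  have hmR : (10000 : ℝ) ≤ m := by exact_mod_cast hm
  have hcard : A.card + B.card = 3 * m := by
    rw [← hV, ← Finset.card_univ, ← hU, Finset.card_union_of_disjoint hAB]
  have hcardR : (A.card : ℝ) + B.card = 3 * m := by exact_mod_cast hcard
  obtain ⟨S, hST, hSX, hSc, hbal⟩ : ∃ S : Finset V, Tileable H S ∧ Disjoint S X ∧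
      (S.card : ℝ) ≤ 6 / 10000 * m ∧ (B \ S).card = 2 * (A \ S).card := by
    rcases le_or_gt m A.card with hmA | hmA
    · obtain ⟨s, hs⟩ := Nat.exists_eq_add_of_le hmA
      have hsR : (A.card : ℝ) = m + s := by exact_mod_cast hs
      obtain ⟨Bs, hBs, hBsc⟩ := Finset.exists_subset_card_eq (s := B) (n := s) (by
        have : (s : ℝ) ≤ B.card := by linarith
        exact_mod_cast this)
      have hAX : ((A \ X).card : ℝ) + X.card = A.card := by
        exact_mod_cast Finset.card_sdiff_add_card_eq_card hXA
      have hAX₁ : (A \ X).card ≤ A.card := Finset.card_le_card Finset.sdiff_subset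
      obtain ⟨Y, hY, -, hYc, hT⟩ := exists_tileable_greedy h3 Bs (A \ X) ∅
        (Finset.disjoint_of_subset_left hBs
          (Finset.disjoint_of_subset_right Finset.sdiff_subset hAB.symm)) (by
        intro b hb
        have h₁ := hB b (hBs hb) (A \ X) Finset.sdiff_subset (A \ X)
        have h₂ := Finset.card_filter_add_card_filter_not (s := (A \ X) ×ˢ (A \ X))
          (fun p => ({b, p.1, p.2} : Finset V) ∈ H)
        rw [Finset.card_product] at h₂
        have h₃ : ((((A \ X) ×ˢ (A \ X)).filter
            fun p => ({b, p.1, p.2} : Finset V) ∈ H).card : ℝ) +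
            (((A \ X) ×ˢ (A \ X)).filter fun p => ({b, p.1, p.2} : Finset V) ∉ H).card =
            (A \ X).card * (A \ X).card := by exact_mod_cast h₂
        rw [hBsc, Finset.card_empty]
        have hlo : 9 / 10 * (m : ℝ) ≤ (A \ X).card := by linarith
        have hsm : (s : ℝ) ≤ 2 / 10000 * m := by linarith
        have : ((2 * (0 + 2 * s) * (A \ X).card : ℕ) : ℝ) < ((((A \ X) ×ˢ (A \ X)).filter
            fun p => ({b, p.1, p.2} : Finset V) ∈ H).card : ℝ) := by
          push_cast
          nlinarith
        exact_mod_cast this)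
      have hYA : Y ⊆ A := hY.trans Finset.sdiff_subset
      refine ⟨Bs ∪ Y, hT, ?_, ?_, ?_⟩
      · rw [Finset.disjoint_union_left]
        exact ⟨Finset.disjoint_of_subset_left hBs (Finset.disjoint_of_subset_right hXA hAB.symm),
          Finset.disjoint_of_subset_left hY Finset.sdiff_disjoint⟩
      · have : (Bs ∪ Y).card ≤ 3 * s := by
          grw [Finset.card_union_le, hYc, hBsc]
          omega
        have : ((Bs ∪ Y).card : ℝ) ≤ 3 * s := by exact_mod_cast this
        linarith
      · have e₁ : B \ (Bs ∪ Y) = B \ Bs := by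
          have := Finset.disjoint_of_subset_left hYA hAB
          rw [Finset.sdiff_union_distrib, Finset.sdiff_eq_self_of_disjoint this.symm]
          exact Finset.inter_eq_left.2 Finset.sdiff_subset
        have e₂ : A \ (Bs ∪ Y) = A \ Y := by
          have := Finset.disjoint_of_subset_right hBs hAB
          rw [Finset.sdiff_union_distrib, Finset.sdiff_eq_self_of_disjoint this]
          exact Finset.inter_eq_right.2 Finset.sdiff_subset
        have e₃ := Finset.card_le_card hYA
        rw [e₁, e₂, Finset.card_sdiff_of_subset hBs, Finset.card_sdiff_of_subset hYA]
        omega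
    · obtain ⟨t, ht⟩ : ∃ t, m = A.card + (t + 1) := ⟨m - A.card - 1, by omega⟩
      have hBt : B.card = 2 * m + (t + 1) := by omega
      have htR : (m : ℝ) = A.card + (t + 1) := by exact_mod_cast ht
      have hBtR : (B.card : ℝ) = 2 * m + (t + 1) := by exact_mod_cast hBt
      obtain ⟨S, hSB, hSc, hT⟩ := exists_tileable_of_degree_bounds h3 B t (4 * m * t + 2)
        ⌊2 / 100 * (m : ℝ) ^ 2⌋₊ (by
          intro v hv
          have h₁ := card_link_univ_le h3 hv
          have h₂ := hdeg v
          rw [hV, hBt] at h₁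
          push_cast at h₁
          have h₃ : (t : ℤ) ≤ t * t := by exact_mod_cast Nat.le_mul_self t
          zify
          linarith) (fun v hv => Nat.le_floor (hBB v hv)) (by
          have h₁ : (⌊2 / 100 * (m : ℝ) ^ 2⌋₊ : ℝ) ≤ 2 / 100 * (m : ℝ) ^ 2 :=
            Nat.floor_le (by positivity)
          have : ((9 * t * ⌊2 / 100 * (m : ℝ) ^ 2⌋₊ : ℕ) : ℝ) <
              ((B.card * (4 * m * t + 2) : ℕ) : ℝ) := by
            push_cast
            calc 9 * (t : ℝ) * ⌊2 / 100 * (m : ℝ) ^ 2⌋₊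
                ≤ 9 * t * (2 / 100 * (m : ℝ) ^ 2) := by gcongr
              _ < 2 * m * (4 * m * t + 2) := by
                have : (0 : ℝ) ≤ t * m ^ 2 := by positivity
                nlinarith
              _ ≤ B.card * (4 * m * t + 2) := by
                gcongr
                rw [hBtR]
                linarith [(Nat.cast_nonneg t : (0 : ℝ) ≤ t)]
          exact_mod_cast this)
      have hAS : Disjoint A S := Finset.disjoint_of_subset_right hSB hAB
      refine ⟨S, hT, (Finset.disjoint_of_subset_left hXA hAS).symm, ?_, ?_⟩
      · rw [hSc]
        push_cast
        linarith
      · rw [Finset.sdiff_eq_self_of_disjoint hAS, Finset.card_sdiff_of_subset hSB]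
        omega
  obtain ⟨Y, hYB, hYS, hYc, hXT⟩ := exists_tileable_greedy h3 X B S
    (Finset.disjoint_of_subset_left hXA hAB) (by
      intro a ha
      have h₁ := hX a ha
      have h₂ : (B.card : ℝ) ≤ 3 * m := by linarith [(Nat.cast_nonneg A.card : (0 : ℝ) ≤ _)]
      have : ((2 * (S.card + 2 * X.card) * B.card : ℕ) : ℝ) <
          ((B ×ˢ B).filter fun p => ({a, p.1, p.2} : Finset V) ∈ H).card := by
        push_cast
        calc 2 * ((S.card : ℝ) + 2 * X.card) * B.card
            ≤ 2 * (6 / 10000 * m + 2 * (2 / 10000 * m)) * (3 * m) := by gcongr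
          _ < 8 / 1000 * (m : ℝ) ^ 2 := by nlinarith
          _ ≤ _ := h₁
      exact_mod_cast this)
  have hXYS : Disjoint S (X ∪ Y) := Finset.disjoint_union_right.2 ⟨hSX, hYS.symm⟩
  have hT := hST.union hXT hXYS
  have hAY : Disjoint A Y := Finset.disjoint_of_subset_right hYB hAB
  have hBX : Disjoint B X := (Finset.disjoint_of_subset_left hXA hAB).symm
  have hA' : A \ (S ∪ (X ∪ Y)) = (A \ S) \ X := by
    ext z
    have := fun h : z ∈ A => Finset.disjoint_left.1 hAY h
    simp only [Finset.mem_sdiff, Finset.mem_union]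
    tauto
  have hB' : B \ (S ∪ (X ∪ Y)) = (B \ S) \ Y := by
    ext z
    have := fun h : z ∈ B => Finset.disjoint_left.1 hBX h
    simp only [Finset.mem_sdiff, Finset.mem_union]
    tauto
  have hXAS : X ⊆ A \ S := Finset.subset_sdiff.2 ⟨hXA, hSX.symm⟩
  have hYBS : Y ⊆ B \ S := Finset.subset_sdiff.2 ⟨hYB, hYS⟩
  have cA : (A \ (S ∪ (X ∪ Y))).card + X.card = (A \ S).card := by
    rw [hA']
    exact Finset.card_sdiff_add_card_eq_card hXAS
  have cB : (B \ (S ∪ (X ∪ Y))).card + Y.card = (B \ S).card := by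
    rw [hB']
    exact Finset.card_sdiff_add_card_eq_card hYBS
  have cS : A.card ≤ (A \ S).card + S.card := Finset.card_le_card_sdiff_add_card
  have hrest := tileable_union_of_few_missing (H := H) (A := A \ (S ∪ (X ∪ Y)))
    (B := B \ (S ∪ (X ∪ Y)))
    (Finset.disjoint_of_subset_left Finset.sdiff_subset
      (Finset.disjoint_of_subset_right Finset.sdiff_subset hAB)) (by omega)
    ⌊2 / 100 * (m : ℝ) ^ 2⌋₊ (by
      have h₁ : (⌊2 / 100 * (m : ℝ) ^ 2⌋₊ : ℝ) ≤ 2 / 100 * (m : ℝ) ^ 2 :=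
        Nat.floor_le (by positivity)
      have cAR : ((A \ (S ∪ (X ∪ Y))).card : ℝ) + X.card = (A \ S).card := by exact_mod_cast cA
      have cSR : (A.card : ℝ) ≤ (A \ S).card + S.card := by exact_mod_cast cS
      set q := (A \ (S ∪ (X ∪ Y))).card
      have hq : 1 / 2 * (m : ℝ) ≤ q := by linarith
      have : ((3 * ⌊2 / 100 * (m : ℝ) ^ 2⌋₊ + 3 * q : ℕ) : ℝ) < ((q ^ 2 : ℕ) : ℝ) := by
        push_cast
        nlinarith
      exact_mod_cast this)
    (by
      intro a ha
      refine Nat.le_floor (le_trans ?_ (hA a ?_))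
      · gcongr <;> exact Finset.sdiff_subset
      · simp only [Finset.mem_sdiff, Finset.mem_union] at ha ⊢
        tauto)
    (by
      intro b hb
      exact Nat.le_floor (hB b (Finset.mem_sdiff.1 hb).1 _ Finset.sdiff_subset _))
  have hall := hT.union hrest (Finset.disjoint_union_right.2
    ⟨Finset.disjoint_sdiff, Finset.disjoint_sdiff⟩)
  convert hall using 1
  rw [← Finset.union_sdiff_distrib, hU, Finset.union_sdiff_of_subset (Finset.subset_univ _)]

lemma card_filter_product_add_le [Fintype V] (P : V × V → Prop) [DecidablePred P]
    {Y B : Finset V} (h : Disjoint Y B) (Z : Finset V) :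
    ((Y ×ˢ Z).filter P).card + ((B ×ˢ B).filter P).card ≤
      ((Finset.univ ×ˢ Finset.univ).filter P).card := by
  rw [← Finset.card_union_of_disjoint]
  · refine Finset.card_le_card (Finset.union_subset ?_ ?_) <;>
    · gcongr <;> exact Finset.subset_univ _
  · refine Finset.disjoint_filter_filter (Finset.disjoint_product.2 (Or.inl h))

lemma sum_card_filter_product_comm (S S' : Finset V) :
    ∑ a ∈ S, ((S' ×ˢ S').filter fun p => ({a, p.1, p.2} : Finset V) ∉ H).card =
      ∑ x ∈ S', ((S ×ˢ S').filter fun p => ({x, p.1, p.2} : Finset V) ∉ H).card := by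
  simp only [Finset.card_filter, Finset.sum_product]
  rw [Finset.sum_comm]
  refine Finset.sum_congr rfl fun x _ => Finset.sum_congr rfl fun a _ =>
    Finset.sum_congr rfl fun y _ => ?_
  rw [Finset.insert_comm]

lemma tileable_univ_of_sparse [Fintype V] (h3 : ∀ e ∈ H, e.card = 3) (m : ℕ)
    (hm : 10 ^ 8 ≤ m) (hV : Fintype.card V = 3 * m) (B₀ : Finset V) (hB₀ : B₀.card = 2 * m)
    (hsparse : ((∑ v ∈ B₀, ((B₀ ×ˢ B₀).filter
      fun p => ({v, p.1, p.2} : Finset V) ∈ H).card : ℕ) : ℝ) ≤ (m : ℝ) ^ 3 / 2000000)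
    (hdeg : ∀ v, 5 * (m : ℤ) ^ 2 - 7 * m + 4 ≤
      ((Finset.univ ×ˢ Finset.univ).filter fun p => ({v, p.1, p.2} : Finset V) ∈ H).card) :
    Tileable H Finset.univ := by
  have hmR : (10 ^ 8 : ℝ) ≤ m := by exact_mod_cast hm
  have hB₀R : (B₀.card : ℝ) = 2 * m := by exact_mod_cast hB₀
  set c : V → ℕ := fun v => ((B₀ ×ˢ B₀).filter fun p => ({v, p.1, p.2} : Finset V) ∈ H).card
    with hc
  set c' : V → ℕ := fun v => ((B₀ ×ˢ B₀).filter fun p => ({v, p.1, p.2} : Finset V) ∉ H).card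
    with hc'
  have hcc : ∀ v, (c v : ℝ) + c' v = 4 * m ^ 2 := by
    intro v
    have := Finset.card_filter_add_card_filter_not (s := B₀ ×ˢ B₀)
      (fun p => ({v, p.1, p.2} : Finset V) ∈ H)
    rw [Finset.card_product, hB₀] at this
    have : c v + c' v = 2 * m * (2 * m) := this
    have : (c v : ℝ) + c' v = 2 * m * (2 * m) := by exact_mod_cast this
    linarith
  have hmiss : ∀ v, (((Finset.univ ×ˢ Finset.univ).filter
      fun p => ({v, p.1, p.2} : Finset V) ∉ H).card : ℝ) ≤ 4 * m ^ 2 + 7 * m := by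
    intro v
    have h₁ := Finset.card_filter_add_card_filter_not
      (s := (Finset.univ ×ˢ Finset.univ : Finset (V × V)))
      (fun p => ({v, p.1, p.2} : Finset V) ∈ H)
    rw [Finset.card_product, Finset.card_univ, hV] at h₁
    have h₂ := hdeg v
    have : (((Finset.univ ×ˢ Finset.univ).filter
      fun p => ({v, p.1, p.2} : Finset V) ∉ H).card : ℤ) ≤ 4 * m ^ 2 + 7 * m := by
      zify at h₁
      linarith
    exact_mod_cast this
  set A := Finset.univ.filter fun v => (m : ℝ) ^ 2 / 100 ≤ c v with hA
  set B := Finset.univ.filter fun v => ¬ (m : ℝ) ^ 2 / 100 ≤ c v with hB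
  set W₁ := B₀ ∩ A with hW₁
  set W₂ := B₀ᶜ.filter fun v => (m : ℝ) ^ 2 / 100 < c' v with hW₂
  have hm2 : (0 : ℝ) < (m : ℝ) ^ 2 / 100 := by positivity
  have cW₁ : (W₁.card : ℝ) ≤ m / 20000 := by
    have h₁ : W₁.card * ((m : ℝ) ^ 2 / 100) ≤ ∑ v ∈ W₁, (c v : ℝ) := by
      rw [← nsmul_eq_mul]
      exact Finset.card_nsmul_le_sum _ _ _ fun v hv => by
        simpa [A] using (Finset.mem_inter.1 hv).2
    have h₂ : ∑ v ∈ W₁, (c v : ℝ) ≤ ∑ v ∈ B₀, (c v : ℝ) :=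
      Finset.sum_le_sum_of_subset_of_nonneg Finset.inter_subset_left (fun _ _ _ => by positivity)
    push_cast at hsparse
    refine le_of_mul_le_mul_right ?_ hm2
    calc _ ≤ _ := h₁
      _ ≤ _ := h₂
      _ ≤ _ := hsparse
      _ = _ := by ring
  have cW₂ : (W₂.card : ℝ) ≤ m / 10000 := by
    have h₁ : W₂.card * ((m : ℝ) ^ 2 / 100) ≤ ∑ v ∈ W₂, (c' v : ℝ) := by
      rw [← nsmul_eq_mul]
      exact Finset.card_nsmul_le_sum _ _ _ fun v hv => (Finset.mem_filter.1 hv).2.le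
    have h₂ : ∑ v ∈ W₂, (c' v : ℝ) ≤ ∑ v ∈ B₀ᶜ, (c' v : ℝ) :=
      Finset.sum_le_sum_of_subset_of_nonneg (Finset.filter_subset _ _)
        (fun _ _ _ => by positivity)
    have h₃ := sum_card_filter_product_comm (H := H) B₀ᶜ B₀
    have h₄ : ∑ v ∈ B₀ᶜ, (c' v : ℝ) ≤ ∑ x ∈ B₀, (7 * m + (c x : ℝ)) := by
      have h₃' : ∑ v ∈ B₀ᶜ, (c' v : ℝ) = ∑ x ∈ B₀, (((B₀ᶜ ×ˢ B₀).filter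
        fun p => ({x, p.1, p.2} : Finset V) ∉ H).card : ℝ) := by exact_mod_cast h₃
      rw [h₃']
      refine Finset.sum_le_sum fun x _ => ?_
      have h := card_filter_product_add_le (fun p : V × V => ({x, p.1, p.2} : Finset V) ∉ H)
        (disjoint_compl_left (a := B₀)) B₀
      have h : (((B₀ᶜ ×ˢ B₀).filter fun p => ({x, p.1, p.2} : Finset V) ∉ H).card : ℝ) + c' x ≤
        ((Finset.univ ×ˢ Finset.univ).filter
          fun p => ({x, p.1, p.2} : Finset V) ∉ H).card := by exact_mod_cast h
      linarith [hmiss x, hcc x]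
    rw [Finset.sum_add_distrib, Finset.sum_const, nsmul_eq_mul, hB₀R] at h₄
    push_cast at hsparse
    refine le_of_mul_le_mul_right ?_ hm2
    calc _ ≤ _ := h₁
      _ ≤ _ := h₂
      _ ≤ _ := h₄
      _ ≤ 2 * m * (7 * m) + (m : ℝ) ^ 3 / 2000000 := by gcongr
      _ ≤ _ := by nlinarith [mul_le_mul_of_nonneg_right hmR hm2.le]
  set W := W₁ ∪ W₂ with hW
  have cW : (W.card : ℝ) ≤ 3 / 20000 * m := by
    have : (W.card : ℝ) ≤ W₁.card + W₂.card := by exact_mod_cast Finset.card_union_le _ _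
    linarith
  have hB₀B : B₀ ⊆ B ∪ W := by
    intro v hv
    by_cases h : (m : ℝ) ^ 2 / 100 ≤ c v
    · simp [W, W₁, A, hv, h]
    · simp [B, lt_of_not_ge h]
  have hBB₀ : B ⊆ B₀ ∪ W := by
    intro v hv
    by_cases h : v ∈ B₀
    · simp [h]
    · have h₁ : ¬ (m : ℝ) ^ 2 / 100 ≤ c v := (Finset.mem_filter.1 hv).2
      have h₂ : (m : ℝ) ^ 2 / 100 < c' v := by linarith [hcc v]
      simp [W, W₂, h, h₂]
  have hAB : Disjoint A B := Finset.disjoint_filter_filter_not _ _ _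
  have hU : A ∪ B = Finset.univ := Finset.filter_union_filter_not_eq _ _
  have hcard : (A.card : ℝ) + B.card = 3 * m := by
    have : A.card + B.card = 3 * m := by
      rw [← hV, ← Finset.card_univ, ← hU, Finset.card_union_of_disjoint hAB]
    exact_mod_cast this
  have cB₁ : (B.card : ℝ) ≤ 2 * m + W.card := by
    rw [← hB₀R]
    exact_mod_cast (Finset.card_le_card hBB₀).trans (Finset.card_union_le _ _)
  have cB₂ : (2 * m : ℝ) ≤ B.card + W.card := by
    rw [← hB₀R]
    exact_mod_cast (Finset.card_le_card hB₀B).trans (Finset.card_union_le _ _)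
  have hWB : 2 * (W.card : ℝ) * B.card ≤ 9 / 10000 * (m : ℝ) ^ 2 := by
    have : (B.card : ℝ) ≤ 3 * m := by linarith [(Nat.cast_nonneg A.card : (0 : ℝ) ≤ _)]
    calc 2 * (W.card : ℝ) * B.card ≤ 2 * (3 / 20000 * m) * (3 * m) := by gcongr
      _ = _ := by ring
  have hWB₀ : 2 * (W.card : ℝ) * B₀.card ≤ 9 / 10000 * (m : ℝ) ^ 2 := by
    rw [hB₀R]
    calc 2 * (W.card : ℝ) * (2 * m) ≤ 2 * (3 / 20000 * m) * (3 * m) := by gcongr; norm_num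
      _ = _ := by ring
  have toB : ∀ (P : V × V → Prop) [DecidablePred P], (((B₀ ×ˢ B₀).filter P).card : ℝ) ≤
      ((B ×ˢ B).filter P).card + 9 / 10000 * (m : ℝ) ^ 2 := by
    intro P _
    have h := card_filter_product_self_le P hB₀B
    have h : (((B₀ ×ˢ B₀).filter P).card : ℝ) ≤
      ((B ×ˢ B).filter P).card + 2 * W.card * B₀.card := by exact_mod_cast h
    linarith
  have toB₀ : ∀ (P : V × V → Prop) [DecidablePred P], (((B ×ˢ B).filter P).card : ℝ) ≤
      ((B₀ ×ˢ B₀).filter P).card + 9 / 10000 * (m : ℝ) ^ 2 := by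
    intro P _
    have h := card_filter_product_self_le P hBB₀
    have h : (((B ×ˢ B).filter P).card : ℝ) ≤
      ((B₀ ×ˢ B₀).filter P).card + 2 * W.card * B.card := by exact_mod_cast h
    linarith
  have hcX : ((A ∩ W).card : ℝ) ≤ W.card := by
    exact_mod_cast Finset.card_le_card Finset.inter_subset_right
  refine tileable_univ_of_partition h3 m (by omega) hV A B (A ∩ W) hAB hU
    Finset.inter_subset_left ?_ ?_ ?_ ?_ (by linarith) (by linarith) (by linarith) hdeg
  · intro b hb Y hY Z
    have h₁ : ¬ (m : ℝ) ^ 2 / 100 ≤ c b := (Finset.mem_filter.1 hb).2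
    have h₂ : (c' b : ℝ) ≤ ((B ×ˢ B).filter fun p => ({b, p.1, p.2} : Finset V) ∉ H).card +
      9 / 10000 * (m : ℝ) ^ 2 := toB _
    have h₃ := card_filter_product_add_le (fun p : V × V => ({b, p.1, p.2} : Finset V) ∉ H)
      (Finset.disjoint_of_subset_left hY hAB) Z
    have h₃ : (((Y ×ˢ Z).filter fun p => ({b, p.1, p.2} : Finset V) ∉ H).card : ℝ) +
      ((B ×ˢ B).filter fun p => ({b, p.1, p.2} : Finset V) ∉ H).card ≤
        ((Finset.univ ×ˢ Finset.univ).filter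
          fun p => ({b, p.1, p.2} : Finset V) ∉ H).card := by exact_mod_cast h₃
    have h₄ := hmiss b
    have h₅ := hcc b
    have h₆ : 7 * (m : ℝ) ≤ (m : ℝ) ^ 2 / 1000 := by nlinarith
    linarith
  · intro b hb
    have h₁ : ¬ (m : ℝ) ^ 2 / 100 ≤ c b := (Finset.mem_filter.1 hb).2
    have h₂ : (((B ×ˢ B).filter fun p => ({b, p.1, p.2} : Finset V) ∈ H).card : ℝ) ≤ c b +
      9 / 10000 * (m : ℝ) ^ 2 := toB₀ _
    linarith
  · intro a ha
    simp only [Finset.mem_sdiff, Finset.mem_inter, W, W₁, W₂, Finset.mem_union, Finset.mem_filter,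
      Finset.mem_compl] at ha
    have h₁ : (c' a : ℝ) ≤ (m : ℝ) ^ 2 / 100 := by
      by_contra h
      have := lt_of_not_ge h
      tauto
    have h₂ : (((B ×ˢ B).filter fun p => ({a, p.1, p.2} : Finset V) ∉ H).card : ℝ) ≤ c' a +
      9 / 10000 * (m : ℝ) ^ 2 := toB₀ _
    linarith
  · intro a ha
    have h₁ : (m : ℝ) ^ 2 / 100 ≤ c a :=
      (Finset.mem_filter.1 (Finset.mem_inter.1 ha).1).2
    have h₂ : (c a : ℝ) ≤ ((B ×ˢ B).filter fun p => ({a, p.1, p.2} : Finset V) ∈ H).card +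
      9 / 10000 * (m : ℝ) ^ 2 := toB _
    linarith

lemma two_mul_degree_le_card_link [Fintype V] (h3 : ∀ e ∈ H, e.card = 3) (v : V) :
    2 * (H.filter fun e => v ∈ e).card ≤
      ((Finset.univ ×ˢ Finset.univ).filter fun p => ({v, p.1, p.2} : Finset V) ∈ H).card := by
  have key : ∀ e ∈ H, v ∈ e → ∀ x y, (x, y) ∈ (e.erase v).offDiag → {v, x, y} = e := by
    intro e he hv x y hxy
    simp only [Finset.mem_offDiag, Finset.mem_erase] at hxy
    refine Finset.eq_of_subset_of_card_le ?_ ?_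
    · intro z hz
      simp only [Finset.mem_insert, Finset.mem_singleton] at hz
      rcases hz with rfl | rfl | rfl
      exacts [hv, hxy.1.2, hxy.2.1.2]
    · rw [h3 e he, Finset.card_eq_three.2 ⟨v, x, y, hxy.1.1.symm, hxy.2.1.1.symm, hxy.2.2, rfl⟩]
  have hdisj : ((H.filter fun e => v ∈ e : Finset (Finset V)) : Set (Finset V)).PairwiseDisjoint
      fun e => (e.erase v).offDiag := by
    intro e he f hf hne
    simp only [Finset.coe_filter, Set.mem_ofPred_eq] at he hf
    refine Finset.disjoint_left.2 fun p hpe hpf => hne ?_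
    rw [← key e he.1 he.2 p.1 p.2 hpe, key f hf.1 hf.2 p.1 p.2 hpf]
  calc 2 * (H.filter fun e => v ∈ e).card
      = ∑ e ∈ H.filter fun e => v ∈ e, (e.erase v).offDiag.card := by
        rw [Finset.sum_congr rfl (g := fun _ => 2), Finset.sum_const, smul_eq_mul, mul_comm]
        intro e he
        rw [Finset.mem_filter] at he
        rw [Finset.offDiag_card, Finset.card_erase_of_mem he.2, h3 e he.1]
    _ = ((H.filter fun e => v ∈ e).biUnion fun e => (e.erase v).offDiag).card :=
        (Finset.card_biUnion hdisj).symm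
    _ ≤ _ := by
        refine Finset.card_le_card ?_
        rintro ⟨x, y⟩ hp
        obtain ⟨e, he, hp⟩ := Finset.mem_biUnion.1 hp
        rw [Finset.mem_filter] at he
        simp [key e he.1 he.2 x y hp, he.1]

lemma card_triples_le (B : Finset V) :
    ((B ×ˢ (B ×ˢ B)).filter fun p => ({p.1, p.2.1, p.2.2} : Finset V) ∈ H).card ≤
      27 * (H.filter fun e => e ⊆ B).card := by
  refine (Finset.card_le_mul_card_image
    (f := fun p : V × V × V => ({p.1, p.2.1, p.2.2} : Finset V)) _ 27 ?_).trans ?_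
  · intro e he
    obtain ⟨p, -, rfl⟩ := Finset.mem_image.1 he
    set e : Finset V := {p.1, p.2.1, p.2.2}
    have hc : e.card ≤ 3 := Finset.card_le_three
    calc _ ≤ (e ×ˢ (e ×ˢ e)).card := by
          refine Finset.card_le_card fun q hq => ?_
          have : ({q.1, q.2.1, q.2.2} : Finset V) = e := (Finset.mem_filter.1 hq).2
          simp only [Finset.mem_product]
          simp [← this]
      _ = e.card * (e.card * e.card) := by simp only [Finset.card_product]
      _ ≤ 3 * (3 * 3) := by gcongr
      _ = 27 := by norm_num
  · gcongr
    intro e he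
    obtain ⟨p, hp, rfl⟩ := Finset.mem_image.1 he
    simp only [Finset.mem_filter, Finset.mem_product] at hp ⊢
    refine ⟨hp.2, ?_⟩
    intro z hz
    simp only [Finset.mem_insert, Finset.mem_singleton] at hz
    rcases hz with rfl | rfl | rfl
    exacts [hp.1.1, hp.1.2.1, hp.1.2.2]

/-- Replacing `B` by a set `B₀` with few vertices outside `B` does not create many edges. -/
lemma sum_card_link_le (B B₀ : Finset V) :
    ∑ v ∈ B₀, ((B₀ ×ˢ B₀).filter fun p => ({v, p.1, p.2} : Finset V) ∈ H).card ≤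
      27 * (H.filter fun e => e ⊆ B).card + 3 * (B₀ \ B).card * B₀.card ^ 2 := by
  have h₁ : ∑ v ∈ B₀, ((B₀ ×ˢ B₀).filter fun p => ({v, p.1, p.2} : Finset V) ∈ H).card =
      ((B₀ ×ˢ (B₀ ×ˢ B₀)).filter fun p => ({p.1, p.2.1, p.2.2} : Finset V) ∈ H).card := by
    simp only [Finset.card_filter, Finset.sum_product]
  have hsub : (B₀ ×ˢ (B₀ ×ˢ B₀)).filter (fun p => ({p.1, p.2.1, p.2.2} : Finset V) ∈ H) ⊆
      (((B ×ˢ (B ×ˢ B)).filter (fun p => ({p.1, p.2.1, p.2.2} : Finset V) ∈ H) ∪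
        (B₀ \ B) ×ˢ (B₀ ×ˢ B₀)) ∪ B₀ ×ˢ ((B₀ \ B) ×ˢ B₀)) ∪ B₀ ×ˢ (B₀ ×ˢ (B₀ \ B)) := by
    rintro ⟨x, y, z⟩ hp
    simp only [Finset.mem_filter, Finset.mem_product, Finset.mem_union, Finset.mem_sdiff] at hp ⊢
    tauto
  have h₂ := Finset.card_le_card hsub
  grw [Finset.card_union_le, Finset.card_union_le, Finset.card_union_le,
    card_triples_le (H := H) B] at h₂
  simp only [Finset.card_product] at h₂
  rw [h₁]
  linarith

end

/-- Extremal case: for `0 < α ≪ 1` and `n` large divisible by 3, every `α`-extremal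
3-graph `H` on `n` vertices with `δ₁(H) ≥ C(n−1,2) − C(2n/3,2) + 1` contains a perfect
matching. -/
theorem stmt4 :
    ∃ α₀ : ℝ, 0 < α₀ ∧ ∀ α : ℝ, 0 < α → α < α₀ →
    ∃ n₀ : ℕ, ∀ n : ℕ, n₀ ≤ n → 3 ∣ n →
    ∀ (V : Type) [Fintype V] [DecidableEq V], Fintype.card V = n →
    ∀ H : Finset (Finset V), (∀ e ∈ H, e.card = 3) →
    (∃ B : Finset V, (2 / 3 - α) * n ≤ (B.card : ℝ) ∧
        ((H.filter fun e => e ⊆ B).card : ℝ) < α * (B.card.choose 3 : ℝ)) →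
    (∀ v : V, (n - 1).choose 2 - (2 * n / 3).choose 2 + 1 ≤ (H.filter fun e => v ∈ e).card) →
    ∃ M : Finset (Finset V), M ⊆ H ∧
      (M : Set (Finset V)).Pairwise (fun e f => Disjoint e f) ∧
      ∀ v : V, ∃ e ∈ M, v ∈ e := by
  refine ⟨1 / 10 ^ 10, by positivity, fun α hα hα₀ => ⟨3 * 10 ^ 8, fun n hn h3n => ?_⟩⟩
  obtain ⟨m, rfl⟩ := h3n
  intro V _ _ hV H h3 ⟨B, hBc, hBe⟩ hdeg
  have hm : 10 ^ 8 ≤ m := by omega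
  suffices h : Tileable H Finset.univ by
    obtain ⟨M, hM, hp, hU⟩ := h
    refine ⟨M, hM, hp, fun v => ?_⟩
    have hv : v ∈ M.biUnion id := hU ▸ Finset.mem_univ v
    simpa using hv
  push_cast at hBc
  obtain ⟨B₀, hB₀, hD⟩ : ∃ B₀ : Finset V, B₀.card = 2 * m ∧
      ((B₀ \ B).card : ℝ) ≤ 3 * α * m := by
    rcases le_total B.card (2 * m) with h | h
    · obtain ⟨B₀, hBB₀, -, hc⟩ := Finset.exists_subsuperset_card_eq (Finset.subset_univ B) h
        (by rw [Finset.card_univ, hV]; omega)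
      refine ⟨B₀, hc, ?_⟩
      have := Finset.card_sdiff_add_card_eq_card hBB₀
      have : ((B₀ \ B).card : ℝ) + B.card = 2 * m := by rw [hc] at this; exact_mod_cast this
      linarith
    · obtain ⟨B₀, hB₀B, hc⟩ := Finset.exists_subset_card_eq h
      refine ⟨B₀, hc, ?_⟩
      rw [Finset.sdiff_eq_empty_iff_subset.2 hB₀B]
      simp only [Finset.card_empty, Nat.cast_zero]
      positivity
  refine tileable_univ_of_sparse h3 m hm hV B₀ hB₀ ?_ ?_
  · have hle := sum_card_link_le (H := H) B B₀
    rw [hB₀] at hle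
    have hch : (B.card.choose 3 : ℝ) ≤ (3 * m) ^ 3 := by
      have : B.card.choose 3 ≤ (3 * m) ^ 3 := by
        refine (Nat.choose_le_pow _ _).trans ?_
        gcongr
        rw [← hV]
        exact Finset.card_le_univ B
      exact_mod_cast this
    calc _ ≤ ((27 * (H.filter fun e => e ⊆ B).card + 3 * (B₀ \ B).card * (2 * m) ^ 2 : ℕ) : ℝ) := by
          exact_mod_cast hle
      _ = 27 * ((H.filter fun e => e ⊆ B).card : ℝ) + 3 * (B₀ \ B).card * (2 * m) ^ 2 := by
          push_cast; ring
      _ ≤ 27 * (α * (3 * m) ^ 3) + 3 * (3 * α * m) * (2 * m) ^ 2 := by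
          gcongr
          exact hBe.le.trans (by gcongr)
      _ = 765 * α * (m : ℝ) ^ 3 := by ring
      _ ≤ 765 * (1 / 10 ^ 10) * (m : ℝ) ^ 3 := by gcongr
      _ ≤ _ := by
          have : (0 : ℝ) ≤ (m : ℝ) ^ 3 := by positivity
          linarith
  · intro v
    have h₁ := two_mul_degree_le_card_link h3 v
    have h₂ := hdeg v
    rw [show 2 * (3 * m) / 3 = 2 * m by omega] at h₂
    have h₃ : ((3 * m - 1).choose 2 : ℚ) ≤
        (H.filter fun e => v ∈ e).card + (2 * m).choose 2 - 1 := by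
      have : (3 * m - 1).choose 2 + 1 ≤ (H.filter fun e => v ∈ e).card + (2 * m).choose 2 := by
        omega
      have : ((3 * m - 1).choose 2 : ℚ) + 1 ≤
        (H.filter fun e => v ∈ e).card + (2 * m).choose 2 := by exact_mod_cast this
      linarith
    rw [Nat.cast_choose_two, Nat.cast_choose_two, Nat.cast_sub (by omega)] at h₃
    push_cast at h₃
    have h₄ : 2 * ((H.filter fun e => v ∈ e).card : ℚ) ≤ ((Finset.univ ×ˢ Finset.univ).filter
      fun p => ({v, p.1, p.2} : Finset V) ∈ H).card := by exact_mod_cast h₁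
    have : 5 * (m : ℚ) ^ 2 - 7 * m + 4 ≤ ((Finset.univ ×ˢ Finset.univ).filter
      fun p => ({v, p.1, p.2} : Finset V) ∈ H).card := by
      linarith
    exact_mod_cast this
end
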